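/- arXiv:2007.13367 — 3 statements merged into one kernel-verified Lean document; each statement's English description precedes it below -/
import Mathlib

section
/- For every finite subset Ξ ⊆ W^a_{O_K}(O_K̄) and every K-algebra homomorphism s : X_Ξ → K̄, there exist σ ∈ Gal(K̄/K) and 𝔞 ∈ I_K such that s(η) = σ(η_𝔞) for all η ∈ X_Ξ, where η_𝔞 denotes the component at 𝔞 of η ∈ K̄^{I_K}. (In other words, X_Ξ is a galois object whose root is the homomorphism η ↦ η_{O_K} given by evaluation at the unit ideal.) -/
open NumberField

set_option synthInstance.maxHeartbeats 1000000
set_option maxHeartbeats 1000000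

def NZI (R : Type*) [CommRing R] [IsDomain R] : Submonoid (Ideal R) where
  carrier := {I | I ≠ ⊥}
  mul_mem' := by
    intro a b ha hb h
    rcases Ideal.mul_eq_bot.mp h with h' | h'
    · exact ha h'
    · exact hb h'
  one_mem' := by
    simpa [Ideal.one_eq_top] using (top_ne_bot : (⊤ : Ideal R) ≠ ⊥)

def shiftI {R : Type*} [CommRing R] [IsDomain R] {A : Type*} (a : NZI R) (ξ : NZI R → A) :
    NZI R → A := fun b => ξ (a * b)

/-- A fixed algebraic closure of `K`. -/
abbrev Kbar (K : Type*) [Field K] := AlgebraicClosure K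

variable (K : Type*) [Field K] [NumberField K]

/-- The sets `U_{O_K, n}(O_K̄)`, viewed inside `K̄^{I_K}`: `U_0` consists of the vectors all
of whose components lie in `O_K̄` (the integral closure of `O_K` in `K̄`), and `U_{n+1}`
consists of those `ξ ∈ U_n` with `ψ_𝔭 ξ - ξ^{N𝔭} ∈ 𝔭·U_n` for all nonzero primes `𝔭`. -/
def USet : ℕ → Set (NZI (𝓞 K) → Kbar K)
  | 0 => {ξ | ∀ a, IsIntegral (𝓞 K) (ξ a)}
  | n + 1 =>
      {ξ | ξ ∈ USet n ∧ ∀ (p : Ideal (𝓞 K)) (_ : p.IsPrime) (hp : p ≠ ⊥),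
        shiftI ⟨p, hp⟩ ξ - ξ ^ Ideal.absNorm p ∈
          Submodule.span (𝓞 K) {x | ∃ r ∈ p, ∃ η ∈ USet n, x = r • η}}

/-- The set `W^a_{O_K}(O_K̄)` of integral Witt vectors: Witt vectors with coefficients in
`O_K̄` that are integral over `O_K`. -/
def WittA : Set (NZI (𝓞 K) → Kbar K) :=
  {ξ | (∀ n, ξ ∈ USet K n) ∧ IsIntegral (𝓞 K) ξ}

/-- The orbit `I_K Ξ = {ψ_𝔞 ξ : 𝔞 ∈ I_K, ξ ∈ Ξ}` of a set of vectors under the shifts. -/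
def orbitSet (Ξ : Set (NZI (𝓞 K) → Kbar K)) : Set (NZI (𝓞 K) → Kbar K) :=
  {x | ∃ a : NZI (𝓞 K), ∃ ξ ∈ Ξ, x = shiftI a ξ}

/-- The `K`-subalgebra `X_Ξ` of `K̄^{I_K}` generated by the orbit of `Ξ` under the shifts. -/
noncomputable def XXi (Ξ : Set (NZI (𝓞 K) → Kbar K)) :
    Subalgebra K (NZI (𝓞 K) → Kbar K) :=
  Algebra.adjoin K (orbitSet K Ξ)

theorem aux_prime (p : Ideal (𝓞 K)) (hpp : p.IsPrime) (hp : p ≠ ⊥) :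
    (∀ r : 𝓞 K, r - r ^ Ideal.absNorm p ∈ p) ∧
    ∃ l f : ℕ, l.Prime ∧ Ideal.absNorm p = l ^ f ∧ (l : 𝓞 K) ∈ p := by
  classical
  have hm : p.IsMaximal := hpp.isMaximal hp
  letI : Field (𝓞 K ⧸ p) := Ideal.Quotient.field p
  haveI : Finite (𝓞 K ⧸ p) := Ideal.finiteQuotientOfFreeOfNeBot p hp
  letI : Fintype (𝓞 K ⧸ p) := Fintype.ofFinite _
  have hc : Ideal.absNorm p = Fintype.card (𝓞 K ⧸ p) := by
    rw [Ideal.absNorm_apply, Submodule.cardQuot_apply, Nat.card_eq_fintype_card]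
  refine ⟨fun r => ?_, ?_⟩
  · rw [← Ideal.Quotient.eq_zero_iff_mem, map_sub, map_pow, hc, FiniteField.pow_card, sub_self]
  · obtain ⟨l, hl⟩ := CharP.exists (𝓞 K ⧸ p)
    obtain ⟨n, h1, h2⟩ := FiniteField.card (𝓞 K ⧸ p) l
    refine ⟨l, n, h1, hc.trans h2, ?_⟩
    rw [← Ideal.Quotient.eq_zero_iff_mem, map_natCast, CharP.cast_eq_zero]

theorem shiftI_add' (a : NZI (𝓞 K)) (x y : NZI (𝓞 K) → Kbar K) :
    shiftI a (x + y) = shiftI a x + shiftI a y := rfl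

theorem aux_smul (r : 𝓞 K) (η : NZI (𝓞 K) → Kbar K) : r • η = algebraMap _ _ r * η := by
  funext b
  change r • (η b) = _
  exact Algebra.smul_def _ _

theorem aux_smem (M : Submodule (𝓞 K) (NZI (𝓞 K) → Kbar K)) (t : 𝓞 K) (x : NZI (𝓞 K) → Kbar K)
    (h : x ∈ M) : algebraMap _ _ t * x ∈ M := by
  rw [← aux_smul]
  exact M.smul_mem t h

theorem aux_span (p : Ideal (𝓞 K)) (n : ℕ) (P : (NZI (𝓞 K) → Kbar K) → Prop) (h0 : P 0)
    (ha : ∀ x y, P x → P y → P (x + y)) (hs : ∀ t x, P x → P (algebraMap (𝓞 K) _ t * x))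
    (hm : ∀ r ∈ p, ∀ η ∈ USet K n, P (algebraMap (𝓞 K) _ r * η)) :
    ∀ x ∈ Submodule.span (𝓞 K) {x | ∃ r ∈ p, ∃ η ∈ USet K n, x = r • η}, P x := by
  intro x hx
  induction hx using Submodule.span_induction with
  | mem x h =>
    obtain ⟨r, hr, η, hη, rfl⟩ := h
    rw [aux_smul]; exact hm r hr η hη
  | zero => exact h0
  | add x z _ _ h1 h2 => exact ha _ _ h1 h2
  | smul c x _ h =>
    have := hs c x h
    rw [← aux_smul] at this
    exact this

theorem aux_USet (n : ℕ) : ∃ S : Subalgebra (𝓞 K) (NZI (𝓞 K) → Kbar K),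
    (S : Set _) = USet K n ∧ ∀ a, ∀ x ∈ S, shiftI a x ∈ S := by
  induction n with
  | zero =>
    refine ⟨{ carrier := USet K 0, mul_mem' := ?_, add_mem' := ?_, algebraMap_mem' := ?_ }, rfl, ?_⟩
    · intro x y hx hy a
      exact (hx a).mul (hy a)
    · intro x y hx hy a
      exact (hx a).add (hy a)
    · intro r a
      exact isIntegral_algebraMap
    · intro a x hx b
      exact hx _
  | succ n ih =>
    obtain ⟨S, hS, hsh⟩ := ih
    have memS : ∀ x, x ∈ USet K n ↔ x ∈ S := by
      intro x; rw [← hS]; rfl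
    let M : Ideal (𝓞 K) → Submodule (𝓞 K) (NZI (𝓞 K) → Kbar K) := fun p =>
      Submodule.span (𝓞 K) {x | ∃ r ∈ p, ∃ η ∈ USet K n, x = r • η}
    have M1 : ∀ p, ∀ r ∈ p, ∀ η ∈ S, algebraMap (𝓞 K) _ r * η ∈ M p :=
      fun p r hr η hη => Submodule.subset_span ⟨r, hr, η, (memS _).2 hη, (aux_smul K r η).symm⟩
    have M2 : ∀ p, ∀ x ∈ M p, ∀ y ∈ S, x * y ∈ M p := by
      intro p x hx y hy
      refine aux_span K p n (fun x => x * y ∈ M p) ?_ ?_ ?_ ?_ x hx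
      · rw [zero_mul]; exact zero_mem _
      · intro x z h1 h2
        rw [add_mul]; exact add_mem h1 h2
      · intro t x h
        rw [mul_assoc]; exact aux_smem K _ _ _ h
      · intro r hr η hη
        rw [mul_assoc]
        exact M1 p r hr _ (S.mul_mem ((memS _).1 hη) hy)
    have M3 : ∀ p, ∀ x ∈ M p, ∀ a, shiftI a x ∈ M p := by
      intro p x hx a
      refine aux_span K p n (fun x => shiftI a x ∈ M p) ?_ ?_ ?_ ?_ x hx
      · exact zero_mem (M p)
      · intro x z h1 h2
        exact add_mem h1 h2
      · intro t x h
        exact aux_smem K (M p) t _ h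
      · intro r hr η hη
        exact M1 p r hr (shiftI a η) (hsh _ _ ((memS _).1 hη))
    have key : ∀ x, x ∈ USet K (n+1) ↔ x ∈ S ∧ ∀ (p : Ideal (𝓞 K)) (_ : p.IsPrime) (hp : p ≠ ⊥),
        shiftI ⟨p, hp⟩ x - x ^ Ideal.absNorm p ∈ M p := by
      intro x
      rw [← memS]; rfl
    refine ⟨{ carrier := USet K (n+1), mul_mem' := ?_, add_mem' := ?_, algebraMap_mem' := ?_ }, rfl, ?_⟩
    · intro x y hx hy
      rw [key] at hx hy ⊢
      refine ⟨S.mul_mem hx.1 hy.1, fun p hpp hp => ?_⟩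
      have h1 := M2 p _ (hx.2 p hpp hp) _ (hsh ⟨p, hp⟩ y hy.1)
      have h2 := M2 p _ (hy.2 p hpp hp) _ (S.pow_mem hx.1 (Ideal.absNorm p))
      have h3 : shiftI ⟨p, hp⟩ (x * y) = shiftI ⟨p, hp⟩ x * shiftI ⟨p, hp⟩ y := rfl
      have := add_mem h1 h2
      rw [h3]
      convert this using 1
      ring
    · intro x y hx hy
      rw [key] at hx hy ⊢
      refine ⟨S.add_mem hx.1 hy.1, fun p hpp hp => ?_⟩
      obtain ⟨l, f, hl, hq, hlp⟩ := (aux_prime K p hpp hp).2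
      obtain ⟨r, hr⟩ := exists_add_pow_prime_pow_eq hl (⟨x, hx.1⟩ : S) (⟨y, hy.1⟩ : S) f
      have hr' := congrArg (Subtype.val) hr
      simp only [Subalgebra.coe_add, Subalgebra.coe_mul, Subalgebra.coe_pow] at hr'
      rw [show ((l : S) : NZI (𝓞 K) → Kbar K) = (l : NZI (𝓞 K) → Kbar K) from rfl] at hr'
      have h1 := add_mem (hx.2 p hpp hp) (hy.2 p hpp hp)
      have h2 := M1 p l hlp (x * y * r.1) (S.mul_mem (S.mul_mem hx.1 hy.1) r.2)
      have h3 : algebraMap (𝓞 K) (NZI (𝓞 K) → Kbar K) l * (x * y * r.1) = (l : NZI (𝓞 K) → Kbar K) * x * y * r.1 := by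
        rw [map_natCast]; ring
      rw [h3] at h2
      have := sub_mem h1 h2
      rw [shiftI_add', hq, hr']
      rw [hq] at this
      convert this using 1
      ring
    · intro r
      rw [key]
      refine ⟨S.algebraMap_mem r, fun p hpp hp => ?_⟩
      have h1 := M1 p _ ((aux_prime K p hpp hp).1 r) 1 S.one_mem
      rw [mul_one, map_sub, map_pow] at h1
      exact h1
    · intro a x hx
      replace hx := (key x).1 hx
      refine (key _).2 ⟨hsh a x hx.1, fun p hpp hp => ?_⟩
      have h1 := M3 p _ (hx.2 p hpp hp) a
      have h2 : shiftI a (shiftI ⟨p, hp⟩ x - x ^ Ideal.absNorm p)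
          = shiftI ⟨p, hp⟩ (shiftI a x) - (shiftI a x) ^ Ideal.absNorm p := by
        ext b
        simp only [shiftI, Pi.sub_apply, Pi.pow_apply]
        rw [mul_left_comm]
      rw [← h2]; exact h1

theorem aux_unif (p : Ideal (𝓞 K)) (hpp : p.IsPrime) (hp : p ≠ ⊥) :
    ∃ ϖ c : 𝓞 K, ϖ ≠ 0 ∧ ϖ ∈ p ∧ c ∉ p ∧ ∀ r ∈ p, ∃ r', c * r = ϖ * r' := by
  obtain ⟨ϖ, h1, h2⟩ := Ideal.exists_mem_pow_notMem_pow_succ p hp hpp.ne_top 1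
  rw [pow_one] at h1
  have hd : p ∣ Ideal.span {ϖ} := by
    rw [Ideal.dvd_span_singleton]; exact h1
  obtain ⟨J, hJ⟩ := hd
  have hJp : ¬ J ≤ p := by
    intro h
    apply h2
    have : ϖ ∈ p * J := by rw [← hJ]; exact Ideal.mem_span_singleton_self ϖ
    have := Ideal.mul_mono_right (I := p) h this
    rw [pow_succ, pow_one]; exact this
  obtain ⟨c, hc, hcp⟩ := SetLike.not_le_iff_exists.1 hJp
  refine ⟨ϖ, c, ?_, h1, hcp, fun r hr => ?_⟩
  · rintro rfl; exact h2 (zero_mem _)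
  · have : r * c ∈ Ideal.span {ϖ} := by rw [hJ]; exact Ideal.mul_mem_mul hr hc
    obtain ⟨r', hr'⟩ := Ideal.mem_span_singleton'.1 this
    exact ⟨r', by rw [mul_comm c, ← hr', mul_comm]⟩

theorem aux_cong (p : Ideal (𝓞 K)) (hpp : p.IsPrime) (hp : p ≠ ⊥) (ϖ c : 𝓞 K) (h0 : ϖ ≠ 0)
    (hc : c ∉ p) (hr : ∀ r ∈ p, ∃ r', c * r = ϖ * r') (N : ℕ) :
    ∀ ξ ∈ USet K N, ∀ b b' : NZI (𝓞 K),
      (∀ i < N, ξ ((⟨p, hp⟩ : NZI (𝓞 K)) ^ i * b) = ξ ((⟨p, hp⟩ : NZI (𝓞 K)) ^ i * b')) →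
      ∃ c' ∉ p, ∃ z : Kbar K, IsIntegral (𝓞 K) z ∧
        algebraMap (𝓞 K) (Kbar K) c' * (ξ ((⟨p, hp⟩ : NZI (𝓞 K)) ^ N * b)
          - ξ ((⟨p, hp⟩ : NZI (𝓞 K)) ^ N * b')) = algebraMap (𝓞 K) (Kbar K) (ϖ ^ N) * z := by
  induction N with
  | zero =>
    intro ξ hξ b b' _
    refine ⟨1, (Ideal.ne_top_iff_one p).1 hpp.ne_top, _, (hξ (⟨p, hp⟩ ^ 0 * b)).sub (hξ (⟨p, hp⟩ ^ 0 * b')), ?_⟩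
    rw [pow_zero ϖ]
  | succ N ih =>
    intro ξ hξ b b' hb
    obtain ⟨S, hS, -⟩ := aux_USet K N
    have memS : ∀ x, x ∈ USet K N ↔ x ∈ S := by
      intro x; rw [← hS]; rfl
    have h1 := hξ.2 p hpp hp
    have h2 : ∀ x ∈ Submodule.span (𝓞 K) {x | ∃ r ∈ p, ∃ η ∈ USet K N, x = r • η},
        ∃ η ∈ S, algebraMap (𝓞 K) _ c * x = algebraMap (𝓞 K) _ ϖ * η := by
      refine aux_span K p N _ ?_ ?_ ?_ ?_
      · exact ⟨0, S.zero_mem, by rw [mul_zero, mul_zero]⟩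
      · rintro x y ⟨u, hu, hu'⟩ ⟨v, hv, hv'⟩
        exact ⟨u + v, S.add_mem hu hv, by rw [mul_add, mul_add, hu', hv']⟩
      · rintro t x ⟨u, hu, hu'⟩
        exact ⟨algebraMap _ _ t * u, S.mul_mem (S.algebraMap_mem t) hu,
          by rw [mul_left_comm, hu', mul_left_comm]⟩
      · intro r hrp η hη
        obtain ⟨r', hr'⟩ := hr r hrp
        exact ⟨algebraMap _ _ r' * η, S.mul_mem (S.algebraMap_mem r') ((memS _).1 hη),
          by rw [← mul_assoc, ← mul_assoc, ← map_mul, ← map_mul, hr']⟩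
    obtain ⟨η, hη, he⟩ := h2 _ h1
    have hinj : Function.Injective (algebraMap (𝓞 K) (Kbar K)) :=
      FaithfulSMul.algebraMap_injective _ _
    have h0' : algebraMap (𝓞 K) (Kbar K) ϖ ≠ 0 := by
      rw [Ne, map_eq_zero_iff _ hinj]; exact h0
    have he' : ∀ d, algebraMap (𝓞 K) (Kbar K) c * (ξ ((⟨p, hp⟩ : NZI (𝓞 K)) * d)
        - ξ d ^ Ideal.absNorm p) = algebraMap (𝓞 K) (Kbar K) ϖ * η d := by
      intro d
      exact congrFun he d
    obtain ⟨c', hc', z, hz, hzz⟩ := ih η ((memS _).2 hη) b b' (by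
      intro i hi
      apply mul_left_cancel₀ h0'
      rw [← he', ← he', ← mul_assoc, ← mul_assoc, ← pow_succ', hb i (by omega),
        hb (i+1) (by omega)])
    refine ⟨c' * c, fun h => (hpp.mem_or_mem h).elim hc' hc, z, hz, ?_⟩
    have e1 := he' ((⟨p, hp⟩ : NZI (𝓞 K)) ^ N * b)
    have e2 := he' ((⟨p, hp⟩ : NZI (𝓞 K)) ^ N * b')
    rw [← mul_assoc, ← pow_succ'] at e1 e2
    rw [← hb N (by omega)] at e2
    rw [map_mul, pow_succ ϖ, map_mul]
    linear_combination (algebraMap (𝓞 K) (Kbar K) c') * (e1 - e2) +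
      (algebraMap (𝓞 K) (Kbar K) ϖ) * hzz

theorem aux_mult (T : Set (Kbar K)) (hT : T.Finite) (hi : ∀ d ∈ T, IsIntegral (𝓞 K) d) :
    ∃ m : 𝓞 K, m ≠ 0 ∧ ∀ d ∈ T, d ≠ 0 → ∃ w, IsIntegral (𝓞 K) w ∧
      algebraMap (𝓞 K) (Kbar K) m = d * w := by
  induction T, hT using Set.Finite.induction_on with
  | empty => exact ⟨1, one_ne_zero, by simp⟩
  | @insert d T _ _ ih =>
    obtain ⟨m, hm, h⟩ := ih (fun x hx => hi x (Set.mem_insert_of_mem _ hx))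
    by_cases hd : d = 0
    · refine ⟨m, hm, fun x hx hx0 => ?_⟩
      rcases hx with rfl | hx
      · exact absurd hd hx0
      · exact h x hx hx0
    · have hdi := hi d (Set.mem_insert _ _)
      let d' : integralClosure (𝓞 K) (Kbar K) := ⟨d, hdi⟩
      have hd' : d' ≠ 0 := fun h => hd (congrArg Subtype.val h)
      have := Ideal.comap_ne_bot_of_integral_mem (R := 𝓞 K) (I := Ideal.span {d'}) hd'
        (Ideal.mem_span_singleton_self d') (Algebra.IsIntegral.isIntegral d')
      obtain ⟨t, ht, ht0⟩ := Submodule.exists_mem_ne_zero_of_ne_bot this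
      obtain ⟨w, hw⟩ := Ideal.mem_span_singleton'.1 (Ideal.mem_comap.1 ht)
      have hw' : w.1 * d = algebraMap (𝓞 K) (Kbar K) t := congrArg Subtype.val hw
      refine ⟨m * t, mul_ne_zero hm ht0, fun x hx hx0 => ?_⟩
      rcases hx with rfl | hx
      · refine ⟨algebraMap _ _ m * w.1, isIntegral_algebraMap.mul w.2, ?_⟩
        rw [map_mul, ← hw']; ring
      · obtain ⟨v, hv, hv'⟩ := h x hx hx0
        refine ⟨v * algebraMap _ _ t, hv.mul isIntegral_algebraMap, ?_⟩
        rw [map_mul, hv']; ring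

theorem aux_contr (x y : 𝓞 K) (hy : y ≠ 0) (z : Kbar K) (hz : IsIntegral (𝓞 K) z)
    (h : algebraMap (𝓞 K) (Kbar K) x = algebraMap (𝓞 K) (Kbar K) y * z) : y ∣ x := by
  have hinj : Function.Injective (algebraMap K (Kbar K)) := (algebraMap K (Kbar K)).injective
  have hy' : algebraMap (𝓞 K) K y ≠ 0 := by
    rw [Ne, map_eq_zero_iff _ (FaithfulSMul.algebraMap_injective _ _)]; exact hy
  have hzz : z = algebraMap K (Kbar K) (algebraMap (𝓞 K) K x / algebraMap (𝓞 K) K y) := by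
    rw [map_div₀, ← IsScalarTower.algebraMap_apply, ← IsScalarTower.algebraMap_apply, h]
    rw [mul_div_cancel_left₀]
    rw [IsScalarTower.algebraMap_apply (𝓞 K) K (Kbar K), Ne, map_eq_zero_iff _ hinj]
    exact hy'
  rw [hzz, isIntegral_algebraMap_iff hinj] at hz
  obtain ⟨w, hw⟩ := IsIntegrallyClosed.isIntegral_iff.1 hz
  refine ⟨w, FaithfulSMul.algebraMap_injective (𝓞 K) K ?_⟩
  rw [map_mul, hw, mul_div_cancel₀ _ hy']

theorem aux_range (ξ : NZI (𝓞 K) → Kbar K) (h : IsIntegral (𝓞 K) ξ) : (Set.range ξ).Finite := by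
  obtain ⟨f, hf, hfx⟩ := h
  refine Set.Finite.subset (Polynomial.rootSet_finite f (Kbar K)) ?_
  rintro _ ⟨a, rfl⟩
  rw [Polynomial.mem_rootSet_of_injective (FaithfulSMul.algebraMap_injective _ _) hf.ne_zero]
  have h1 : Polynomial.aeval ξ f = 0 := hfx
  have := congrArg (Pi.evalAlgHom (𝓞 K) (fun _ : NZI (𝓞 K) => Kbar K) a) h1
  rw [← Polynomial.aeval_algHom_apply, map_zero] at this
  exact this

theorem aux_comb (R : Type*) [CommRing R] [IsDedekindDomain R] {α : Type*} (ξ : NZI R → α)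
    (hS : (Set.range ξ).Finite) (I : Ideal R) (hI : I ≠ 0)
    (hD : ∀ P : NZI R, Prime P.1 → ∀ i : ℕ, ¬ P.1 ^ (i+1) ∣ I → ∀ b b' : NZI R,
      (∀ j < i + 1, ξ (P ^ j * b) = ξ (P ^ j * b')) → ξ (P ^ (i+1) * b) = ξ (P ^ (i+1) * b')) :
    (Set.range (fun a => shiftI a ξ)).Finite := by
  classical
  let E := {e : NZI R // e.1 ∣ I}
  have : Finite {x : Ideal R // x ∣ I} :=
    @Finite.of_fintype _ (UniqueFactorizationMonoid.fintypeSubtypeDvd _ hI)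
  have : Finite E := Finite.of_injective
    (fun e : E => (⟨e.1.1, e.2⟩ : {x : Ideal R // x ∣ I})) (by
      intro e e' h
      have h' : e.1.1 = e'.1.1 := congrArg (fun t => t.1) h
      exact Subtype.ext (Subtype.ext h'))
  let rel : NZI R → NZI R → Prop := fun b b' => ∀ e : NZI R, e.1 ∣ I → ξ (e * b) = ξ (e * b')
  have step : ∀ P : NZI R, Prime P.1 → ∀ b b', rel b b' → rel (P * b) (P * b') := by
    intro P hpr b b' h e hedvd
    by_cases hpe : (P * e).1 ∣ I
    · have := h (P * e) hpe
      have g : ∀ d, e * (P * d) = P * e * d := by intro d; rw [← mul_assoc, mul_comm e]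
      rw [g, g]
      exact this
    · obtain ⟨e', he1, he2⟩ := (FiniteMultiplicity.of_prime_left hpr
        (show e.1 ≠ 0 from e.2)).exists_eq_pow_mul_and_not_dvd
      generalize multiplicity P.1 e.1 = i at he1
      have he0 : e' ≠ ⊥ := by
        rintro rfl; exact he2 (dvd_zero _)
      have hnd : ¬ P.1 ^ (i+1) ∣ I := by
        rintro ⟨t, ht⟩
        obtain ⟨s, hs⟩ := hedvd
        rw [he1, ht, pow_succ, mul_assoc, mul_assoc] at hs
        have hs' := mul_left_cancel₀ (pow_ne_zero i hpr.ne_zero) hs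
        have : P.1 ∣ e' * s := ⟨t, hs'.symm⟩
        obtain ⟨u, rfl⟩ := (hpr.dvd_or_dvd this).resolve_left he2
        apply hpe
        refine ⟨u, ?_⟩
        rw [Submonoid.coe_mul, ht, he1, pow_succ, mul_assoc, hs']
        ring
      let e'' : NZI R := ⟨e', he0⟩
      have hee : e = P ^ i * e'' := Subtype.ext he1
      have g : ∀ d, e * (P * d) = P ^ (i+1) * (e'' * d) := by
        intro d; rw [hee, pow_succ]; ac_rfl
      rw [g, g]
      apply hD P hpr i hnd
      intro j hj
      rw [← mul_assoc, ← mul_assoc]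
      apply h
      refine dvd_trans ?_ hedvd
      rw [he1]
      exact mul_dvd_mul_right (pow_dvd_pow P.1 (by omega)) e'
  have all : ∀ (a : Ideal R) (A : NZI R), A.1 = a → ∀ b b', rel b b' → rel (A * b) (A * b') := by
    intro a
    induction a using UniqueFactorizationMonoid.induction_on_prime with
    | h₁ => intro A ha; exact absurd ha A.2
    | h₂ x hx =>
      intro A hA b b' h
      have : A = 1 := Subtype.ext
        (hA.trans ((Ideal.isUnit_iff.1 hx).trans Ideal.one_eq_top.symm))
      rw [this, one_mul, one_mul]; exact h
    | h₃ a p ha hp ih =>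
      intro A hA b b' h
      let P : NZI R := ⟨p, hp.ne_zero⟩
      let A' : NZI R := ⟨a, ha⟩
      have hAA : A = P * A' := Subtype.ext hA
      have h1 := step P hp _ _ (ih A' rfl b b' h)
      rw [hAA, mul_assoc, mul_assoc]
      exact h1
  have all' : ∀ a b b', rel b b' → ξ (a * b) = ξ (a * b') := by
    intro a b b' h
    have := all a.1 a rfl b b' h 1 (one_dvd _)
    rw [one_mul, one_mul] at this
    exact this
  have : Finite (Set.range ξ) := hS
  let κ : NZI R → (E → Set.range ξ) := fun b e => ⟨ξ (e.1 * b), _, rfl⟩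
  let Q := Set.range κ
  let H : (Q → Set.range ξ) → (NZI R → α) := fun g b => (g ⟨κ b, b, rfl⟩).1
  refine (Set.finite_range H).subset ?_
  rintro _ ⟨a, rfl⟩
  refine ⟨fun q => ⟨ξ (a * q.2.choose), _, rfl⟩, ?_⟩
  ext b
  apply all'
  have hk := (⟨κ b, b, rfl⟩ : Q).2.choose_spec
  intro e he
  exact congrArg Subtype.val (congrFun hk ⟨e, he⟩)

theorem aux_orbit (ξ : NZI (𝓞 K) → Kbar K) (hξ : ξ ∈ WittA K) :
    (Set.range (fun a => shiftI a ξ)).Finite := by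
  have hS := aux_range K ξ hξ.2
  obtain ⟨m, hm0, hm⟩ := aux_mult K (Set.image2 (fun x y => x - y) (Set.range ξ) (Set.range ξ))
    (hS.image2 _ hS) (by
      rintro _ ⟨_, ⟨a, rfl⟩, _, ⟨b, rfl⟩, rfl⟩
      exact (hξ.1 0 a).sub (hξ.1 0 b))
  have hI0 : Ideal.span {m} ≠ 0 := by
    rw [Ideal.zero_eq_bot, Ne, Ideal.span_singleton_eq_bot]; exact hm0
  refine aux_comb (𝓞 K) ξ hS (Ideal.span {m}) hI0 ?_
  rintro ⟨p, hp⟩ hpr i hnd b b' hb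
  have hpp : p.IsPrime := Ideal.isPrime_of_prime hpr
  obtain ⟨ϖ, c, h1, h2, h3, h4⟩ := aux_unif K p hpp hp
  obtain ⟨c', hc', z, hz, hzz⟩ := aux_cong K p hpp hp ϖ c h1 h3 h4 (i+1) ξ (hξ.1 _) b b' hb
  by_contra hne
  obtain ⟨w, hw, hw'⟩ := hm _ (Set.mem_image2_of_mem (Set.mem_range_self _)
    (Set.mem_range_self _)) (sub_ne_zero.2 hne)
  have hdv := aux_contr K (c' * m) (ϖ ^ (i+1)) (pow_ne_zero _ h1) (z * w) (hz.mul hw) (by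
    rw [map_mul, hw', ← mul_assoc, ← mul_assoc, ← hzz])
  apply hnd
  have hcm : c' * m ∈ p ^ (i+1) := Ideal.mem_of_dvd _ hdv (Ideal.pow_mem_pow h2 _)
  have h5 : p ^ (i+1) ∣ Ideal.span {c'} * Ideal.span {m} := by
    rw [Ideal.span_singleton_mul_span_singleton, Ideal.dvd_span_singleton]; exact hcm
  exact Prime.pow_dvd_of_dvd_mul_left hpr _ (by rwa [Ideal.dvd_span_singleton]) h5

/-- For every finite `Ξ ⊆ W^a_{O_K}(O_K̄)` and every `K`-algebra
homomorphism `s : X_Ξ → K̄`, there are `σ ∈ Gal(K̄/K)` and `𝔞 ∈ I_K` with `s(η) = σ(η_𝔞)`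
for all `η ∈ X_Ξ`; i.e. `X_Ξ` is a galois object rooted at evaluation at the unit ideal. -/
theorem XXi_is_galois_object
    (Ξ : Set (NZI (𝓞 K) → Kbar K)) (hfin : Ξ.Finite) (hΞ : Ξ ⊆ WittA K)
    (s : XXi K Ξ →ₐ[K] Kbar K) :
    ∃ (σ : Kbar K ≃ₐ[K] Kbar K) (a : NZI (𝓞 K)),
      ∀ η : XXi K Ξ, s η = σ ((η : NZI (𝓞 K) → Kbar K) a) := by
  classical
  let ev : NZI (𝓞 K) → (XXi K Ξ →ₐ[K] Kbar K) := fun a =>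
    (Pi.evalAlgHom K (fun _ : NZI (𝓞 K) => Kbar K) a).comp (XXi K Ξ).val
  have hev : ∀ a η, ev a η = (η : NZI (𝓞 K) → Kbar K) a := fun _ _ => rfl
  haveI : Finite Ξ := hfin
  have hfinev : (Set.range ev).Finite := by
    let G : NZI (𝓞 K) → (Ξ → (NZI (𝓞 K) → Kbar K)) := fun a ξ => shiftI a ξ.1
    have hG : (Set.range G).Finite := by
      refine (Set.Finite.pi (fun ξ : Ξ => aux_orbit K ξ.1 (hΞ ξ.2))).subset ?_
      rintro _ ⟨a, rfl⟩ ξ _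
      exact ⟨a, rfl⟩
    have hGe : ∀ a a', G a = G a' → ev a = ev a' := by
      intro a a' h
      ext ⟨η, hη⟩
      change η a = η a'
      induction hη using Algebra.adjoin_induction with
      | mem x hx =>
        obtain ⟨b, ξ, hξ, rfl⟩ := hx
        have := congrFun (congrFun h ⟨ξ, hξ⟩) b
        simp only [G, shiftI] at this ⊢
        rw [mul_comm b, mul_comm b]; exact this
      | algebraMap r => rfl
      | add x y _ _ h1 h2 => rw [Pi.add_apply, Pi.add_apply, h1, h2]
      | mul x y _ _ h1 h2 => rw [Pi.mul_apply, Pi.mul_apply, h1, h2]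
    haveI : Finite (Set.range G) := hG
    refine (Set.finite_range (fun q : Set.range G => ev q.2.choose)).subset ?_
    rintro _ ⟨a, rfl⟩
    exact ⟨⟨G a, a, rfl⟩, hGe _ _ (⟨G a, a, rfl⟩ : Set.range G).2.choose_spec⟩
  have hker : ∃ a, RingHom.ker (ev a) ≤ RingHom.ker s := by
    have hp : (RingHom.ker s).IsPrime := RingHom.ker_isPrime s
    have := (hp.inf_le' (s := hfinev.toFinset) (f := fun φ => RingHom.ker φ)).1 (by
      intro η hη
      have : η = 0 := by
        apply Subtype.ext
        funext a
        have h1 := (Finset.inf_le (f := fun φ : XXi K Ξ →ₐ[K] Kbar K => RingHom.ker φ)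
          (hfinev.mem_toFinset.2 ⟨a, rfl⟩)) hη
        exact h1
      rw [this]; exact zero_mem _)
    obtain ⟨φ, hφ, h⟩ := this
    obtain ⟨a, rfl⟩ := hfinev.mem_toFinset.1 hφ
    exact ⟨a, h⟩
  obtain ⟨a, ha⟩ := hker
  let F : IntermediateField K (Kbar K) := 
    Subalgebra.IsAlgebraic.toIntermediateField (S := (ev a).range)
      (fun x _ => Algebra.IsAlgebraic.isAlgebraic x)
  let f : XXi K Ξ →ₐ[K] F := (ev a).rangeRestrict
  have hf : Function.Surjective f := (ev a).rangeRestrict_surjective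
  have hfk : RingHom.ker f = RingHom.ker (ev a) := by
    ext x
    rw [RingHom.mem_ker, RingHom.mem_ker]
    exact Subtype.ext_iff
  let φ : F →ₐ[K] Kbar K := AlgHom.liftOfSurjective f hf s (hfk.le.trans ha)
  let τ : Kbar K →ₐ[K] Kbar K := φ.liftNormal (Kbar K)
  refine ⟨AlgEquiv.ofBijective τ (Algebra.IsAlgebraic.algHom_bijective τ), a, fun η => ?_⟩
  have h1 : τ (algebraMap F (Kbar K) (f η)) = φ (f η) := φ.liftNormal_commutes (Kbar K) (f η)
  have h2 : φ (f η) = s η := AlgHom.liftOfSurjective_apply ..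
  rw [← h2, ← h1]
  rfl
end

section
/- Let ξ ∈ W^a_{O_K}(O_K̄) be an integral Witt vector. Define the congruence ≡_ξ on I_K by 𝔞 ≡_ξ 𝔟 iff ψ_𝔞 ξ = ψ_𝔟 ξ, let M_ξ := I_K/≡_ξ (a finite commutative monoid), and let 𝒥 be the equivalence on M_ξ with x ∼_𝒥 y iff x·M_ξ = y·M_ξ. Then, for any set of representatives 𝔞_1, …, 𝔞_r ∈ I_K of the 𝒥-classes of M_ξ, there is an isomorphism of K-algebras X_ξ ≅ ∏_{i=1}^{r} K(ξ_{𝔞_i 𝔟} : 𝔟 ∈ I_K), where K(ξ_{𝔞_i 𝔟} : 𝔟 ∈ I_K) is the intermediate field of K̄/K generated over K by the coefficients ξ_{𝔞_i 𝔟} for 𝔟 ∈ I_K. In particular, the number of simple factors of X_ξ equals the cardinality of M_ξ/𝒥. -/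
open NumberField

set_option synthInstance.maxHeartbeats 1000000
set_option maxHeartbeats 1000000

variable (K : Type*) [Field K] [NumberField K]

/-- `𝔞 ≤_𝒥 𝔟` relative to `ξ`: in the quotient monoid `M_ξ = I_K/≡_ξ`, the class of `𝔞`
lies in the ideal generated by the class of `𝔟`, i.e. `ψ_𝔞 ξ = ψ_{𝔟𝔠} ξ` for some `𝔠`. -/
def JBelow (ξ : NZI (𝓞 K) → Kbar K) (a b : NZI (𝓞 K)) : Prop :=
  ∃ c : NZI (𝓞 K), shiftI (b * c) ξ = shiftI a ξ

/-- `𝒥`-equivalence of (the classes in `M_ξ` of) `𝔞` and `𝔟`. -/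
def JEquiv (ξ : NZI (𝓞 K) → Kbar K) (a b : NZI (𝓞 K)) : Prop :=
  JBelow K ξ a b ∧ JBelow K ξ b a


section
open NumberField Filter Topology

noncomputable def wtE (K : Type*) [Field K] [NumberField K] (s : ℝ) (I : Ideal (𝓞 K)) : ENNReal :=
  ENNReal.ofReal ((Ideal.absNorm I : ℝ) ^ (-s))

lemma wtE_mul (K : Type*) [Field K] [NumberField K] (s : ℝ) (I J : Ideal (𝓞 K)) :
    wtE K s (I * J) = wtE K s I * wtE K s J := by
  unfold wtE
  rw [map_mul, Nat.cast_mul, Real.mul_rpow (by positivity) (by positivity),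
    ENNReal.ofReal_mul (by positivity)]

lemma wtE_one (K : Type*) [Field K] [NumberField K] (s : ℝ) :
    wtE K s 1 = 1 := by
  simp [wtE]

lemma wtE_prod (K : Type*) [Field K] [NumberField K] (s : ℝ) (m : Multiset (Ideal (𝓞 K))) :
    wtE K s m.prod = (m.map (wtE K s)).prod := by
  induction m using Multiset.induction_on with
  | empty => rw [Multiset.prod_zero, wtE_one]; simp
  | cons a m ih => simp [wtE_mul, ih]

lemma tsum_wtE_eq (K : Type*) [Field K] [NumberField K] (s : ℝ) (hs : 1 < s)
    (hz : dedekindZeta K s ≠ 0) :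
    ∑' I, wtE K s I = ENNReal.ofReal (dedekindZeta K s).re ∧
      0 ≤ (dedekindZeta K s).re ∧ (dedekindZeta K s).im = 0 := by
  set f : ℕ → ℂ := fun n ↦ Nat.card {I : Ideal (𝓞 K) // Ideal.absNorm I = n} with hf
  have hsum : LSeriesSummable f s := by
    by_contra h
    exact hz (by rw [dedekindZeta, LSeries]; exact tsum_eq_zero_of_not_summable h)
  set g : ℕ → ℝ := fun n ↦
    Nat.card {I : Ideal (𝓞 K) // Ideal.absNorm I = n} * (n : ℝ) ^ (-s) with hg
  have hg0 : ∀ n, 0 ≤ g n := fun n => by positivity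
  have hfg : ∀ n, LSeries.term f s n = (g n : ℂ) := by
    intro n
    rcases eq_or_ne n 0 with rfl | hn
    · have : (0:ℝ) ^ (-s) = 0 := Real.zero_rpow (by linarith)
      simp [hg, this]
    · rw [LSeries.term_of_ne_zero hn, hg, hf]
      simp only [Complex.ofReal_mul, Complex.ofReal_natCast]
      rw [div_eq_mul_inv, Real.rpow_neg (by positivity), Complex.ofReal_inv,
        Complex.ofReal_cpow (by positivity)]
      simp
  have hgs : Summable g := by
    have : Summable (fun n => (g n : ℂ)) := by
      refine Summable.congr hsum ?_
      intro n; exact (hfg n)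
    exact_mod_cast this
  have hval : dedekindZeta K s = ((∑' n, g n : ℝ) : ℂ) := by
    rw [dedekindZeta, LSeries, Complex.ofReal_tsum]
    exact tsum_congr hfg
  refine ⟨?_, ?_, ?_⟩
  · rw [hval, Complex.ofReal_re, ENNReal.ofReal_tsum_of_nonneg hg0 hgs,
      ← (Equiv.sigmaFiberEquiv (fun I : Ideal (𝓞 K) => Ideal.absNorm I)).tsum_eq,
      ENNReal.tsum_sigma']
    refine tsum_congr fun n => ?_
    have : ∀ I : {I : Ideal (𝓞 K) // Ideal.absNorm I = n},
        wtE K s (Equiv.sigmaFiberEquiv (fun I : Ideal (𝓞 K) => Ideal.absNorm I) ⟨n, I⟩)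
          = ENNReal.ofReal ((n : ℝ) ^ (-s)) := by
      intro I
      have := I.2
      simp [wtE, Equiv.sigmaFiberEquiv, this]
    rw [tsum_congr this]
    have hfin : Finite {I : Ideal (𝓞 K) // Ideal.absNorm I = n} :=
      Ideal.finite_setOfPred_absNorm_eq n
    cases nonempty_fintype {I : Ideal (𝓞 K) // Ideal.absNorm I = n}
    rw [tsum_fintype, hg]
    simp [ENNReal.ofReal_mul]
  · rw [hval, Complex.ofReal_re]; exact tsum_nonneg hg0
  · rw [hval, Complex.ofReal_im]

lemma tendsto_tsum_wtE (K : Type*) [Field K] [NumberField K] :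
    Tendsto (fun s : ℝ => ENNReal.ofReal (s - 1) * ∑' I, wtE K s I) (𝓝[>] 1)
      (𝓝 (ENNReal.ofReal (dedekindZeta_residue K))) := by
  have h := tendsto_sub_one_mul_dedekindZeta_nhdsGT K
  have h1 : ∀ᶠ s : ℝ in 𝓝[>] 1, ((s : ℂ) - 1) * dedekindZeta K s ≠ 0 :=
    h.eventually_ne (by exact_mod_cast dedekindZeta_residue_ne_zero K)
  have h2 := ENNReal.tendsto_ofReal ((Complex.continuous_re.tendsto _).comp h)
  rw [Complex.ofReal_re] at h2
  refine h2.congr' ?_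
  filter_upwards [h1, self_mem_nhdsWithin] with s hs hs1
  have hs1 : 1 < s := hs1
  obtain ⟨e, p, i⟩ := tsum_wtE_eq K s hs1 (right_ne_zero_of_mul hs)
  rw [e, ← ENNReal.ofReal_mul (by linarith)]
  simp [Complex.mul_re, i]

lemma wtE_le_half (K : Type*) [Field K] [NumberField K] (s : ℝ) (hs : 1 < s) (p : Ideal (𝓞 K))
    (hp : p.IsPrime) (hp0 : p ≠ ⊥) : wtE K s p ≤ 2⁻¹ := by
  have h2 : 2 ≤ Ideal.absNorm p := by
    have h0 : Ideal.absNorm p ≠ 0 := by simpa [Ideal.absNorm_eq_zero_iff] using hp0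
    have h1 : Ideal.absNorm p ≠ 1 := by simpa [Ideal.absNorm_eq_one_iff] using hp.ne_top
    omega
  have h2' : (2:ℝ) ≤ Ideal.absNorm p := by exact_mod_cast h2
  have : (Ideal.absNorm p : ℝ) ^ (-s) ≤ 2⁻¹ := by
    rw [Real.rpow_neg (by positivity)]
    apply inv_anti₀ (by norm_num)
    calc (2:ℝ) ≤ Ideal.absNorm p := h2'
      _ = (Ideal.absNorm p : ℝ) ^ (1:ℝ) := by simp
      _ ≤ _ := Real.rpow_le_rpow_of_exponent_le (by linarith) hs.le
  unfold wtE
  refine (ENNReal.ofReal_le_ofReal this).trans (le_of_eq ?_)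
  rw [ENNReal.ofReal_inv_of_pos (by norm_num)]; simp

open Classical in
lemma tsum_wtE_sieve (K : Type*) [Field K] [NumberField K] (s : ℝ) (hs : 1 < s)
    (hfin : ∑' I, wtE K s I ≠ ⊤) (S : Finset (Ideal (𝓞 K))) :
    (∀ p ∈ S, p.IsPrime ∧ p ≠ ⊥) →
    ∑' I, wtE K s I ≤ 2 ^ S.card * ∑' I, (if ∀ p ∈ S, ¬ p ∣ I then wtE K s I else 0) := by
  induction S using Finset.induction_on with
  | empty => intro _; simp
  | insert p S hpS ih =>
    intro hS
    obtain ⟨hp, hp0⟩ := hS p (Finset.mem_insert_self _ _)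
    have ih := ih (fun q hq => hS q (Finset.mem_insert_of_mem hq))
    refine ih.trans ?_
    rw [Finset.card_insert_of_notMem hpS, pow_succ, mul_assoc]
    gcongr
    set A := ∑' I, (if ∀ q ∈ S, ¬ q ∣ I then wtE K s I else 0) with hA
    set B := ∑' I, (if ∀ q ∈ insert p S, ¬ q ∣ I then wtE K s I else 0) with hB
    have hAfin : A ≠ ⊤ := by
      refine ne_top_of_le_ne_top hfin (ENNReal.tsum_le_tsum fun I => ?_)
      split_ifs <;> simp
    have key : A ≤ B + 2⁻¹ * A := by
      have h1 : A ≤ B + ∑' I, (if (∀ q ∈ S, ¬ q ∣ I) ∧ p ∣ I then wtE K s I else 0) := by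
        rw [hA, hB, ← ENNReal.tsum_add]
        refine ENNReal.tsum_le_tsum fun I => ?_
        by_cases h1 : ∀ q ∈ S, ¬ q ∣ I <;> by_cases h2 : p ∣ I <;>
          simp [h1, h2]
      refine h1.trans ?_
      gcongr
      have hinj : Function.Injective (fun J : Ideal (𝓞 K) => p * J) :=
        fun a b h => mul_left_cancel₀ hp0 h
      have h3 : ∑' I, (if (∀ q ∈ S, ¬ q ∣ I) ∧ p ∣ I then wtE K s I else 0)
          = ∑' J, (if (∀ q ∈ S, ¬ q ∣ p * J) ∧ p ∣ p * J then wtE K s (p * J) else 0) := by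
        refine (hinj.tsum_eq (f := fun I => (if (∀ q ∈ S, ¬ q ∣ I) ∧ p ∣ I then wtE K s I else 0))
          ?_).symm
        intro I hI
        simp only [Function.mem_support, ne_eq, ite_eq_right_iff, not_forall] at hI
        obtain ⟨⟨_, J, rfl⟩, _⟩ := hI
        exact ⟨J, rfl⟩
      rw [h3, hA, ← ENNReal.tsum_mul_left]
      refine ENNReal.tsum_le_tsum fun J => ?_
      by_cases h1 : ∀ q ∈ S, ¬ q ∣ J
      · rw [if_pos h1]
        split_ifs
        · rw [wtE_mul]; gcongr; exact wtE_le_half K s hs p hp hp0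
        · simp
      · rw [if_neg, if_neg h1]
        · simp
        · push Not at h1
          obtain ⟨q, hq, hq'⟩ := h1
          exact fun h => h.1 q hq (hq'.mul_left p)
    have h2 : 2⁻¹ * A ≤ B := by
      have hA2 : A = 2⁻¹ * A + 2⁻¹ * A := by
        rw [← add_mul, ENNReal.inv_two_add_inv_two, one_mul]
      have hne : 2⁻¹ * A ≠ ⊤ := ENNReal.mul_ne_top (by simp) hAfin
      nth_rewrite 1 [hA2] at key
      exact (ENNReal.add_le_add_iff_right hne).mp key
    calc A = 2 * (2⁻¹ * A) := by
          rw [← mul_assoc, ENNReal.mul_inv_cancel (by simp) (by simp), one_mul]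
      _ ≤ 2 * B := by gcongr

end

section
open NumberField Filter Topology

open Classical in
lemma tsum_wtE_sq_le (K : Type*) [Field K] [NumberField K] (F : Type*) [Field F] [NumberField F]
    (s : ℝ) (S : Finset (Ideal (𝓞 K))) (PP : Type*) (v : PP → Ideal (𝓞 K))
    (hv : ∀ p : Ideal (𝓞 K), p.IsPrime → p ≠ ⊥ → p ∉ S → ∃ x, v x = p)
    (P : PP ⊕ PP → Ideal (𝓞 F)) (hP : Function.Injective P)
    (hprime : ∀ x, (P x).IsPrime ∧ P x ≠ ⊥)
    (hnorm : ∀ x, Ideal.absNorm (P (Sum.inl x)) = Ideal.absNorm (v x) ∧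
      Ideal.absNorm (P (Sum.inr x)) = Ideal.absNorm (v x)) (hs : 1 < s) :
    (∑' I, (if ∀ p ∈ S, ¬ p ∣ I then wtE K s I else 0)) ^ 2 ≤ ∑' I, wtE F s I := by
  set Z := ∑' m : Multiset PP, (m.map fun x => wtE K s (v x)).prod with hZ
  have h1 : ∑' I, (if ∀ p ∈ S, ¬ p ∣ I then wtE K s I else 0) ≤ Z := by
    let G := {I : Ideal (𝓞 K) // (∀ p ∈ S, ¬ p ∣ I) ∧ I ≠ ⊥}
    have hG : ∀ I : G, ∃ m : Multiset PP, (m.map v).prod = I.1 := by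
      rintro ⟨I, hI, hI0⟩
      have hex : ∀ p ∈ UniqueFactorizationMonoid.normalizedFactors I, ∃ x, v x = p := by
        intro p hp
        have hpr := UniqueFactorizationMonoid.prime_of_normalized_factor p hp
        refine hv p (Ideal.isPrime_of_prime hpr) hpr.ne_zero ?_
        intro hpS
        exact hI p hpS (UniqueFactorizationMonoid.dvd_of_mem_normalizedFactors hp)
      choose f hf using hex
      refine ⟨(UniqueFactorizationMonoid.normalizedFactors I).attach.map fun x => f x.1 x.2, ?_⟩
      rw [Multiset.map_map, Multiset.map_congr rfl (g := Subtype.val) (by intro x hx; exact hf x.1 x.2),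
        Multiset.attach_map_val]
      exact associated_iff_eq.mp (UniqueFactorizationMonoid.prod_normalizedFactors hI0)
    choose M hM using hG
    have hMinj : Function.Injective M := by
      intro a b h
      apply Subtype.ext
      rw [← hM a, ← hM b, h]
    have h2 : ∑' I, (if ∀ p ∈ S, ¬ p ∣ I then wtE K s I else 0) = ∑' I : G, wtE K s I.1 := by
      have hinj : Function.Injective (fun I : G => I.1) := Subtype.val_injective
      rw [← hinj.tsum_eq]
      · refine tsum_congr fun I => ?_
        rw [if_pos I.2.1]
      · intro I hI
        simp only [Function.mem_support, ne_eq, ite_eq_right_iff, not_forall] at hI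
        obtain ⟨h1, h2⟩ := hI
        refine ⟨⟨I, h1, ?_⟩, rfl⟩
        rintro rfl
        apply h2
        have : (0:ℝ) ^ (-s) = 0 := Real.zero_rpow (by linarith)
        simp [wtE, this]
    rw [h2, hZ]
    refine le_trans (le_of_eq ?_) (ENNReal.tsum_comp_le_tsum_of_injective hMinj _)
    refine tsum_congr fun I => ?_
    rw [← hM I, wtE_prod, Multiset.map_map]
    rfl
  have h2 : Z ^ 2 ≤ ∑' I, wtE F s I := by
    let Φ : Multiset PP × Multiset PP → Ideal (𝓞 F) := fun m =>
      ((m.1.map Sum.inl + m.2.map Sum.inr).map P).prod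
    have hΦ : Function.Injective Φ := by
      intro m m' h
      have hnf : ∀ t : Multiset (PP ⊕ PP),
          UniqueFactorizationMonoid.normalizedFactors (t.map P).prod = t.map P := by
        intro t
        apply UniqueFactorizationMonoid.normalizedFactors_prod_of_prime
        intro p hp
        obtain ⟨x, _, rfl⟩ := Multiset.mem_map.mp hp
        exact Ideal.prime_of_isPrime (hprime x).2 (hprime x).1
      have h3 := congrArg UniqueFactorizationMonoid.normalizedFactors h
      simp only [Φ] at h3
      rw [hnf, hnf] at h3
      have h4 := Multiset.map_injective hP h3
      have h5 := congrArg (Multiset.filterMap Sum.getLeft?) h4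
      have h6 := congrArg (Multiset.filterMap Sum.getRight?) h4
      rw [Multiset.filterMap_add, Multiset.filterMap_add] at h5 h6
      simp only [Multiset.filterMap_map] at h5 h6
      have e1 : ((Sum.getLeft? : PP ⊕ PP → Option PP) ∘ (Sum.inl : PP → PP ⊕ PP)) = some := rfl
      have e2 : ((Sum.getLeft? : PP ⊕ PP → Option PP) ∘ (Sum.inr : PP → PP ⊕ PP)) = fun _ => none := rfl
      have e3 : ((Sum.getRight? : PP ⊕ PP → Option PP) ∘ (Sum.inr : PP → PP ⊕ PP)) = some := rfl
      have e4 : ((Sum.getRight? : PP ⊕ PP → Option PP) ∘ (Sum.inl : PP → PP ⊕ PP)) = fun _ => none := rfl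
      have e5 : ∀ t : Multiset PP, t.filterMap (fun _ => (none : Option PP)) = 0 := by
        intro t
        induction t using Multiset.induction_on with
        | empty => simp
        | cons a t ih => rw [Multiset.filterMap_cons_none _ _ rfl, ih]
      rw [e1, e2] at h5
      rw [e3, e4] at h6
      rw [e5, e5, Multiset.filterMap_some, Multiset.filterMap_some, add_zero, add_zero] at h5
      rw [e5, e5, Multiset.filterMap_some, Multiset.filterMap_some, zero_add, zero_add] at h6
      exact Prod.ext h5 h6
    refine le_trans (le_of_eq ?_) (ENNReal.tsum_comp_le_tsum_of_injective hΦ _)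
    rw [ENNReal.tsum_prod', sq, hZ, ← ENNReal.tsum_mul_right]
    refine tsum_congr fun m => ?_
    rw [← ENNReal.tsum_mul_left]
    refine tsum_congr fun m' => ?_
    simp only [Φ]
    rw [wtE_prod, Multiset.map_map, Multiset.map_add, Multiset.prod_add, Multiset.map_map,
      Multiset.map_map]
    congr 2
    · refine Multiset.map_congr rfl fun x _ => ?_
      simp [wtE, (hnorm x).1]
    · refine Multiset.map_congr rfl fun x _ => ?_
      simp [wtE, (hnorm x).2]
  exact (pow_le_pow_left' h1 2).trans h2

theorem no_double_cover (K : Type*) [Field K] [NumberField K] (F : Type*) [Field F] [NumberField F]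
    (S : Finset (Ideal (𝓞 K))) (hS : ∀ p ∈ S, p.IsPrime ∧ p ≠ ⊥) (PP : Type*) (v : PP → Ideal (𝓞 K))
    (hv : ∀ p : Ideal (𝓞 K), p.IsPrime → p ≠ ⊥ → p ∉ S → ∃ x, v x = p)
    (P : PP ⊕ PP → Ideal (𝓞 F)) (hP : Function.Injective P)
    (hprime : ∀ x, (P x).IsPrime ∧ P x ≠ ⊥)
    (hnorm : ∀ x, Ideal.absNorm (P (Sum.inl x)) = Ideal.absNorm (v x) ∧
      Ideal.absNorm (P (Sum.inr x)) = Ideal.absNorm (v x)) : False := by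
  classical
  have hK := tendsto_tsum_wtE K
  have hF := tendsto_tsum_wtE F
  set κ := dedekindZeta_residue K
  set κ' := dedekindZeta_residue F
  have hκ : 0 < κ := dedekindZeta_residue_pos K
  set C : ENNReal := (2 ^ S.card) ^ 2 with hC
  -- (s-1)^2 ζ_K^2 ≤ (s-1) * C * ((s-1) ζ_F)
  have hev : ∀ᶠ s : ℝ in 𝓝[>] 1,
      (ENNReal.ofReal (s - 1) * ∑' I, wtE K s I) ^ 2 ≤
        ENNReal.ofReal (s - 1) * (C * (ENNReal.ofReal (s - 1) * ∑' I, wtE F s I)) := by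
    have hlt : ∀ᶠ s : ℝ in 𝓝[>] 1, ENNReal.ofReal (s - 1) * ∑' I, wtE K s I < ⊤ :=
      hK.eventually_lt_const ENNReal.ofReal_lt_top
    filter_upwards [hlt, self_mem_nhdsWithin] with s h1 hs
    have hs : 1 < s := hs
    have hfin : ∑' I, wtE K s I ≠ ⊤ := by
      intro h
      rw [h, ENNReal.mul_top (by simpa using hs)] at h1
      exact lt_irrefl _ h1
    have a1 := tsum_wtE_sieve K s hs hfin S hS
    have a2 := tsum_wtE_sq_le K F s S PP v hv P hP hprime hnorm hs
    calc _ = ENNReal.ofReal (s - 1) * ENNReal.ofReal (s - 1) * (∑' I, wtE K s I) ^ 2 := by ring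
      _ ≤ ENNReal.ofReal (s - 1) * ENNReal.ofReal (s - 1) * (2 ^ S.card * ∑' I, (if ∀ p ∈ S, ¬ p ∣ I then wtE K s I else 0)) ^ 2 := by gcongr
      _ = ENNReal.ofReal (s - 1) * ENNReal.ofReal (s - 1) * (C * (∑' I, (if ∀ p ∈ S, ¬ p ∣ I then wtE K s I else 0)) ^ 2) := by rw [mul_pow]
      _ ≤ ENNReal.ofReal (s - 1) * ENNReal.ofReal (s - 1) * (C * ∑' I, wtE F s I) := by gcongr
      _ = _ := by ring
  have hl : Tendsto (fun s : ℝ => (ENNReal.ofReal (s - 1) * ∑' I, wtE K s I) ^ 2) (𝓝[>] 1)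
      (𝓝 (ENNReal.ofReal κ ^ 2)) := ENNReal.Tendsto.pow hK
  have h0 : Tendsto (fun s : ℝ => ENNReal.ofReal (s - 1)) (𝓝[>] 1) (𝓝 0) := by
    have : Tendsto (fun s : ℝ => s - 1) (𝓝[>] 1) (𝓝 0) := by
      have : Tendsto (fun s : ℝ => s - 1) (𝓝 1) (𝓝 (1 - 1)) := tendsto_id.sub_const 1
      rw [sub_self] at this
      exact this.mono_left nhdsWithin_le_nhds
    simpa using ENNReal.tendsto_ofReal this
  have hCt : C ≠ ⊤ := by simp [hC]
  have hr : Tendsto (fun s : ℝ => ENNReal.ofReal (s - 1) *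
      (C * (ENNReal.ofReal (s - 1) * ∑' I, wtE F s I))) (𝓝[>] 1)
      (𝓝 (0 * (C * ENNReal.ofReal κ'))) := by
    refine ENNReal.Tendsto.mul h0 (Or.inr ?_) (ENNReal.Tendsto.const_mul hF (Or.inr hCt))
      (Or.inr (by simp))
    exact ENNReal.mul_ne_top hCt (by simp)
  have := le_of_tendsto_of_tendsto hl hr hev
  simp at this
  linarith

end

section
open NumberField

lemma degree_one_bij {A B : Type*} [CommRing A] [CommRing B] [Algebra A B] (Q : Ideal B)
    [Q.IsPrime] [Finite (B ⧸ Q)]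
    (h : ∀ x : B, x ^ Nat.card (A ⧸ Q.under A) - x ∈ Q) :
    Function.Bijective (algebraMap (A ⧸ Q.under A) (B ⧸ Q)) := by
  have hinj : Function.Injective (algebraMap (A ⧸ Q.under A) (B ⧸ Q)) :=
    Ideal.algebraMap_quotient_injective
  have : Finite (A ⧸ Q.under A) := .of_injective _ hinj
  refine (Nat.bijective_iff_injective_and_card _).mpr ⟨hinj, ?_⟩
  refine le_antisymm (Nat.card_le_card_of_injective _ hinj) ?_
  classical
  cases nonempty_fintype (B ⧸ Q)
  set q := Nat.card (A ⧸ Q.under A)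
  have hq : 1 < q := by
    have : Nontrivial (A ⧸ Q.under A) := Ideal.Quotient.nontrivial_iff.mpr
      (Ideal.IsPrime.under A Q).ne_top
    exact Finite.one_lt_card
  letI := Fintype.fieldOfDomain (B ⧸ Q)
  have hdeg := FiniteField.X_pow_card_sub_X_natDegree_eq (B ⧸ Q) hq
  have hne := FiniteField.X_pow_card_sub_X_ne_zero (B ⧸ Q) hq
  rw [Nat.card_eq_fintype_card, ← Finset.card_univ, ← hdeg]
  refine Polynomial.card_le_degree_of_subset_roots ?_
  intro x _
  rw [Polynomial.mem_roots hne]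
  obtain ⟨x, rfl⟩ := Ideal.Quotient.mk_surjective x
  have := Ideal.Quotient.eq_zero_iff_mem.mpr (h x)
  simpa using this

open scoped Pointwise in
theorem frob_generate (K L : Type*) [Field K] [NumberField K] [Field L] [NumberField L]
    [Algebra K L] [IsGalois K L] (H : Subgroup (L ≃ₐ[K] L)) (δ : 𝓞 L) (hδ : δ ≠ 0)
    (hH : ∀ (Q : Ideal (𝓞 L)), Q.IsPrime → Q ≠ ⊥ → δ ∉ Q → ∀ σ : L ≃ₐ[K] L,
      (∀ x : 𝓞 L, σ • x - x ^ (Nat.card (𝓞 K ⧸ Q.under (𝓞 K))) ∈ Q) → σ ∈ H) : H = ⊤ := by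
  by_contra hne
  obtain ⟨τ, hτ⟩ : ∃ τ, τ ∉ H := by
    by_contra! h
    exact hne (eq_top_iff.mpr fun x _ => h x)
  let F := IntermediateField.fixedField H
  obtain ⟨θ, hθ⟩ : ∃ θ : 𝓞 F, τ • (algebraMap (𝓞 F) (𝓞 L) θ) ≠ algebraMap (𝓞 F) (𝓞 L) θ := by
    by_contra! h
    apply hτ
    rw [← IntermediateField.fixingSubgroup_fixedField H, IntermediateField.mem_fixingSubgroup_iff]
    intro x hx
    obtain ⟨a, b, hb, hab⟩ := IsFractionRing.div_surjective (A := 𝓞 F) (⟨x, hx⟩ : F)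
    have e : x = ((algebraMap (𝓞 F) (𝓞 L) a : 𝓞 L) : L) / ((algebraMap (𝓞 F) (𝓞 L) b : 𝓞 L) : L) := by
      have := congrArg (algebraMap F L) hab
      rw [map_div₀] at this
      exact this.symm
    rw [e, map_div₀]
    have ha := congrArg (fun z : 𝓞 L => (z : L)) (h a)
    have hb := congrArg (fun z : 𝓞 L => (z : L)) (h b)
    exact congrArg₂ _ ha hb
  have hfixF : ∀ σ ∈ H, ∀ x : 𝓞 F, σ • (algebraMap (𝓞 F) (𝓞 L) x) = algebraMap (𝓞 F) (𝓞 L) x := by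
    intro σ hσ x
    apply RingOfIntegers.ext
    exact (x : F).2 ⟨σ, hσ⟩
  set θ' := algebraMap (𝓞 F) (𝓞 L) θ with hθ'
  set δ' := δ * (τ • θ' - θ') with hδ'
  have hδ'0 : δ' ≠ 0 := mul_ne_zero hδ (sub_ne_zero.mpr hθ)
  have hfin : {v : IsDedekindDomain.HeightOneSpectrum (𝓞 L) | v.asIdeal ∣ Ideal.span {δ'}}.Finite :=
    Ideal.finite_factors (by simpa using hδ'0)
  classical
  let S : Finset (Ideal (𝓞 K)) := hfin.toFinset.image fun v => v.asIdeal.under (𝓞 K)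
  have hunder_ne : ∀ Q : Ideal (𝓞 L), Q ≠ ⊥ → Q.under (𝓞 K) ≠ ⊥ := fun Q hQ h =>
    hQ (Ideal.eq_bot_of_comap_eq_bot h)
  have hS : ∀ p ∈ S, p.IsPrime ∧ p ≠ ⊥ := by
    intro p hp
    obtain ⟨v, _, rfl⟩ := Finset.mem_image.mp hp
    have := v.isPrime
    exact ⟨Ideal.IsPrime.under _ _, hunder_ne _ v.ne_bot⟩
  have hSmem : ∀ Q : Ideal (𝓞 L), Q.IsPrime → Q ≠ ⊥ → δ' ∈ Q → Q.under (𝓞 K) ∈ S := by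
    intro Q h1 h2 h3
    refine Finset.mem_image.mpr ⟨⟨Q, h1, h2⟩, ?_, rfl⟩
    rw [Set.Finite.mem_toFinset]
    simpa [Ideal.dvd_iff_le, Ideal.span_le] using h3
  let PP := {p : Ideal (𝓞 K) // p.IsPrime ∧ p ≠ ⊥ ∧ p ∉ S}
  have hex : ∀ p : PP, ∃ Q : Ideal (𝓞 L), Q.IsPrime ∧ Q.under (𝓞 K) = p.1 := by
    rintro ⟨p, hp, hp0, hpS⟩
    obtain ⟨Q, _, hQ, hQp⟩ := Ideal.exists_ideal_over_prime_of_isIntegral (S := 𝓞 L) p ⊥ (by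
      rw [Ideal.comap_bot_of_injective _ (FaithfulSMul.algebraMap_injective _ _)]; exact bot_le)
    exact ⟨Q, hQ, hQp⟩
  choose PL hPLprime hPLu using hex
  have hbij : ∀ Q : Ideal (𝓞 L), Q.IsPrime → Q ≠ ⊥ → Q.under (𝓞 K) ∉ S →
      Function.Bijective (algebraMap (𝓞 K ⧸ (Q.under (𝓞 F)).under (𝓞 K)) (𝓞 F ⧸ (Q.under (𝓞 F)))) := by
    intro Q hQ hQ0 hQS
    have hF0 : Q.under (𝓞 F) ≠ ⊥ := fun h => hQ0 (Ideal.eq_bot_of_comap_eq_bot h)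
    have : (Q.under (𝓞 F)).IsPrime := Ideal.IsPrime.under _ _
    have : Finite (𝓞 F ⧸ Q.under (𝓞 F)) := Ideal.finiteQuotientOfFreeOfNeBot _ hF0
    have : Finite (𝓞 L ⧸ Q) := Ideal.finiteQuotientOfFreeOfNeBot _ hQ0
    apply degree_one_bij
    intro x
    obtain ⟨σ, hσ⟩ := IsArithFrobAt.exists_of_isInvariant (𝓞 K) (L ≃ₐ[K] L) Q
    have hδQ : δ ∉ Q := fun h => hQS (hSmem Q hQ hQ0 (Q.mul_mem_right _ h))
    have hσH : σ ∈ H := hH Q hQ hQ0 hδQ σ (fun x => hσ x)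
    have h1 := hσ (algebraMap (𝓞 F) (𝓞 L) x)
    have h2 : (Q.under (𝓞 F)).under (𝓞 K) = Q.under (𝓞 K) := Ideal.under_under Q
    rw [h2, Ideal.under, Ideal.mem_comap, map_sub, map_pow]
    rw [MulSemiringAction.toAlgHom_apply, hfixF σ hσH] at h1
    rw [← neg_mem_iff, neg_sub]
    exact h1
  have hnrm : ∀ Q : Ideal (𝓞 L), Q.IsPrime → Q ≠ ⊥ → Q.under (𝓞 K) ∉ S →
      Ideal.absNorm (Q.under (𝓞 F)) = Ideal.absNorm (Q.under (𝓞 K)) := by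
    intro Q h1 h2 h3
    have h := Nat.card_congr (Equiv.ofBijective _ (hbij Q h1 h2 h3))
    have h2 : (Q.under (𝓞 F)).under (𝓞 K) = Q.under (𝓞 K) := Ideal.under_under Q
    rw [h2] at h
    rw [Ideal.absNorm_apply, Ideal.absNorm_apply, Submodule.cardQuot_apply,
      Submodule.cardQuot_apply]
    exact h.symm
  have hPL0 : ∀ p, PL p ≠ ⊥ := by
    intro p h
    apply p.2.2.1
    rw [← hPLu p, h]
    exact Ideal.comap_bot_of_injective _ (FaithfulSMul.algebraMap_injective _ _)
  let PL2 : PP → Ideal (𝓞 L) := fun p => τ⁻¹ • PL p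
  have hPL2prime : ∀ p, (PL2 p).IsPrime := by
    intro p
    have := hPLprime p
    simp only [PL2]; infer_instance
  have hPL2u : ∀ p, (PL2 p).under (𝓞 K) = p.1 := by
    intro p
    rw [← hPLu p]
    ext r
    simp only [Ideal.under, Ideal.mem_comap, PL2, Ideal.mem_inv_pointwise_smul_iff,
      smul_algebraMap]
  have hPL20 : ∀ p, PL2 p ≠ ⊥ := by
    intro p h
    apply p.2.2.1
    rw [← hPL2u p, h]
    exact Ideal.comap_bot_of_injective _ (FaithfulSMul.algebraMap_injective _ _)
  refine no_double_cover K F S hS PP Subtype.val (fun p h1 h2 h3 => ⟨⟨p, h1, h2, h3⟩, rfl⟩)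
    (Sum.elim (fun p => (PL p).under (𝓞 F)) (fun p => (PL2 p).under (𝓞 F))) ?_ ?_ ?_
  · have hne : ∀ p, (PL p).under (𝓞 F) ≠ (PL2 p).under (𝓞 F) := by
      intro p h
      obtain ⟨r, hr⟩ := (hbij (PL p) (hPLprime p) (hPL0 p) (by rw [hPLu]; exact p.2.2.2)).2
        (Ideal.Quotient.mk _ θ)
      obtain ⟨r, rfl⟩ := Ideal.Quotient.mk_surjective r
      have hr' : algebraMap (𝓞 K) (𝓞 F) r - θ ∈ (PL p).under (𝓞 F) := Ideal.Quotient.eq.mp hr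
      have hr2 := hr'
      rw [h] at hr2
      simp only [Ideal.under, Ideal.mem_comap, PL2, Ideal.mem_inv_pointwise_smul_iff, map_sub,
        smul_sub, ← IsScalarTower.algebraMap_apply, smul_algebraMap] at hr' hr2
      have h3 := sub_mem hr' hr2
      rw [sub_sub_sub_cancel_left] at h3
      have := hSmem (PL p) (hPLprime p) (hPL0 p) (Ideal.mul_mem_left _ _ h3)
      rw [hPLu] at this
      exact p.2.2.2 this
    have hu : ∀ Q : Ideal (𝓞 L), (Q.under (𝓞 F)).under (𝓞 K) = Q.under (𝓞 K) :=
      fun Q => Ideal.under_under Q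
    rintro (x | x) (y | y) hxy <;> simp only [Sum.elim_inl, Sum.elim_inr] at hxy <;>
      have e := congrArg (fun I => Ideal.under (𝓞 K) I) hxy <;>
      simp only [hu, hPLu, hPL2u] at e <;> obtain rfl := Subtype.ext e
    · rfl
    · exact (hne _ hxy).elim
    · exact (hne _ hxy.symm).elim
    · rfl
  · rintro (x | x)
    · have := hPLprime x
      exact ⟨Ideal.IsPrime.under _ _, fun h => hPL0 x (Ideal.eq_bot_of_comap_eq_bot h)⟩
    · have := hPL2prime x
      exact ⟨Ideal.IsPrime.under _ _, fun h => hPL20 x (Ideal.eq_bot_of_comap_eq_bot h)⟩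
  · intro x
    constructor
    · rw [Sum.elim_inl, hnrm _ (hPLprime x) (hPL0 x) (by rw [hPLu]; exact x.2.2.2), hPLu]
    · rw [Sum.elim_inr, hnrm _ (hPL2prime x) (hPL20 x) (by rw [hPL2u]; exact x.2.2.2), hPL2u]

end



lemma prime_norm_facts (p : Ideal (𝓞 K)) (hp : p.IsPrime) (hp0 : p ≠ ⊥) :
    (∃ l f : ℕ, l.Prime ∧ Ideal.absNorm p = l ^ f ∧ f ≠ 0 ∧ (l : 𝓞 K) ∈ p) ∧
    ∀ r : 𝓞 K, r - r ^ Ideal.absNorm p ∈ p := by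
  classical
  have hfin : Finite (𝓞 K ⧸ p) := Ideal.finiteQuotientOfFreeOfNeBot _ hp0
  cases nonempty_fintype (𝓞 K ⧸ p)
  let _ := Fintype.fieldOfDomain (𝓞 K ⧸ p)
  have hcard : Ideal.absNorm p = Fintype.card (𝓞 K ⧸ p) := by
    rw [Ideal.absNorm_apply, Submodule.cardQuot_apply, Nat.card_eq_fintype_card]
  obtain ⟨l, hc⟩ := CharP.exists (𝓞 K ⧸ p)
  obtain ⟨f, hl, hf⟩ := FiniteField.card (𝓞 K ⧸ p) l
  refine ⟨⟨l, f, hl, hcard.trans hf, f.ne_zero, ?_⟩, ?_⟩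
  · rw [← Ideal.Quotient.eq_zero_iff_mem, map_natCast]
    exact CharP.cast_eq_zero _ _
  · intro r
    rw [← Ideal.Quotient.eq, map_pow, hcard, FiniteField.pow_card]

lemma shiftI_shiftI {R : Type*} [CommRing R] [IsDomain R] {A : Type*} (a b : NZI R) (ξ : NZI R → A) :
    shiftI a (shiftI b ξ) = shiftI b (shiftI a ξ) := by
  funext c
  simp only [shiftI]
  rw [← mul_assoc, ← mul_assoc, mul_comm a b]

lemma smul_fun (r : 𝓞 K) (η : NZI (𝓞 K) → Kbar K) :
    r • η = algebraMap (𝓞 K) (NZI (𝓞 K) → Kbar K) r * η := by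
  funext a; exact Algebra.smul_def r (η a)

lemma smul_K (r : 𝓞 K) (η : NZI (𝓞 K) → Kbar K) : r • η = (r : K) • η := rfl

lemma smul_pt (r : 𝓞 K) (η : NZI (𝓞 K) → Kbar K) (a) :
    (r • η) a = algebraMap K (Kbar K) (r : K) * η a := by
  rw [smul_K]; exact Algebra.smul_def (r : K) (η a)

lemma smulK_pt (r : K) (η : NZI (𝓞 K) → Kbar K) (a) :
    (r • η) a = algebraMap K (Kbar K) r * η a := Algebra.smul_def r (η a)

lemma mul_smul_fun (r : 𝓞 K) (y η : NZI (𝓞 K) → Kbar K) : y * r • η = r • (y * η) := by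
  rw [smul_fun, smul_fun]; ring

lemma subalg_smul (A : Subalgebra (𝓞 K) (NZI (𝓞 K) → Kbar K)) (r : 𝓞 K) (x) (hx : x ∈ A) :
    r • x ∈ A := by
  rw [smul_fun]; exact mul_mem (A.algebraMap_mem r) hx

/-- the span `𝔭·U` -/
noncomputable def pSpan (U : Set (NZI (𝓞 K) → Kbar K)) (p : Ideal (𝓞 K)) :
    Submodule (𝓞 K) (NZI (𝓞 K) → Kbar K) :=
  Submodule.span (𝓞 K) {x | ∃ r ∈ p, ∃ η ∈ U, x = r • η}

lemma USet_succ (n : ℕ) (ξ : NZI (𝓞 K) → Kbar K) : ξ ∈ USet K (n+1) ↔ ξ ∈ USet K n ∧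
    ∀ (p : Ideal (𝓞 K)) (_ : p.IsPrime) (hp : p ≠ ⊥),
        shiftI ⟨p, hp⟩ ξ - ξ ^ Ideal.absNorm p ∈ pSpan K (USet K n) p := Iff.rfl

theorem USet_subalgebra (n : ℕ) : ∃ A : Subalgebra (𝓞 K) (NZI (𝓞 K) → Kbar K),
    (A : Set (NZI (𝓞 K) → Kbar K)) = USet K n ∧ ∀ a, ∀ x ∈ A, shiftI a x ∈ A := by
  induction n with
  | zero =>
    refine ⟨{ carrier := USet K 0
              mul_mem' := fun {x y} hx hy a => (hx a).mul (hy a)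
              add_mem' := fun {x y} hx hy a => (hx a).add (hy a)
              algebraMap_mem' := fun r a => isIntegral_algebraMap }, rfl, ?_⟩
    intro a x hx b
    exact hx (a * b)
  | succ n ih =>
    obtain ⟨A, hA, hsh⟩ := ih
    have hAm : ∀ x, x ∈ USet K n ↔ x ∈ A := by intro x; rw [← hA]; rfl
    have h1 : ∀ (p : Ideal (𝓞 K)) (r : 𝓞 K) (y), r ∈ p → y ∈ A → r • y ∈ pSpan K (USet K n) p := by
      intro p r y hr hy
      exact Submodule.subset_span ⟨r, hr, y, (hAm y).2 hy, rfl⟩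
    have h2 : ∀ (p : Ideal (𝓞 K)) (u y), y ∈ A → u ∈ pSpan K (USet K n) p →
        y * u ∈ pSpan K (USet K n) p := by
      intro p u y hy hu
      induction hu using Submodule.span_induction with
      | mem x hx =>
        obtain ⟨r, hr, η, hη, rfl⟩ := hx
        rw [mul_smul_fun]
        exact h1 p r _ hr (mul_mem hy ((hAm _).1 hη))
      | zero => rw [mul_zero]; exact zero_mem _
      | add a b _ _ ha hb => rw [mul_add]; exact add_mem ha hb
      | smul r a _ ha =>
        have e : y * r • a = r • (y * a) := mul_smul_fun K r y a
        exact e ▸ Submodule.smul_mem _ r ha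
    have h3 : ∀ (p : Ideal (𝓞 K)) (u) (a), u ∈ pSpan K (USet K n) p →
        shiftI a u ∈ pSpan K (USet K n) p := by
      intro p u a hu
      induction hu using Submodule.span_induction with
      | mem x hx =>
        obtain ⟨r, hr, η, hη, rfl⟩ := hx
        exact h1 p r (shiftI a η) hr (hsh a _ ((hAm _).1 hη))
      | zero => exact zero_mem (pSpan K (USet K n) p)
      | add x y _ _ hx hy => exact add_mem hx hy
      | smul r x _ hx => exact Submodule.smul_mem _ r hx
    refine ⟨{ carrier := USet K (n+1)
              mul_mem' := ?_
              add_mem' := ?_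
              algebraMap_mem' := ?_ }, rfl, ?_⟩
    · intro x y hx hy
      rw [USet_succ] at hx hy ⊢
      refine ⟨(hAm _).2 (mul_mem ((hAm _).1 hx.1) ((hAm _).1 hy.1)), fun p hp hp0 => ?_⟩
      have e : shiftI ⟨p, hp0⟩ (x * y) - (x * y) ^ Ideal.absNorm p =
          shiftI ⟨p, hp0⟩ x * (shiftI ⟨p, hp0⟩ y - y ^ Ideal.absNorm p) +
          y ^ Ideal.absNorm p * (shiftI ⟨p, hp0⟩ x - x ^ Ideal.absNorm p) := by
        have : shiftI ⟨p, hp0⟩ (x * y) = shiftI ⟨p, hp0⟩ x * shiftI ⟨p, hp0⟩ y := rfl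
        rw [this, mul_pow]; ring
      rw [e]
      exact add_mem (h2 p _ _ (hsh _ _ ((hAm _).1 hx.1)) (hy.2 p hp hp0))
        (h2 p _ _ (pow_mem ((hAm _).1 hy.1) _) (hx.2 p hp hp0))
    · intro x y hx hy
      rw [USet_succ] at hx hy ⊢
      refine ⟨(hAm _).2 (add_mem ((hAm _).1 hx.1) ((hAm _).1 hy.1)), fun p hp hp0 => ?_⟩
      obtain ⟨⟨l, f, hl, hlf, hf, hlp⟩, _⟩ := prime_norm_facts K p hp hp0
      have hx' := hx.2 p hp hp0
      have hy' := hy.2 p hp hp0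
      obtain ⟨z, hz⟩ := exists_add_pow_prime_pow_eq hl (⟨x, (hAm _).1 hx.1⟩ : A)
        (⟨y, (hAm _).1 hy.1⟩ : A) f
      have hz' := congrArg (fun t : A => (t : NZI (𝓞 K) → Kbar K)) hz
      push_cast at hz'
      rw [hlf] at hx' hy' ⊢
      have e : shiftI ⟨p, hp0⟩ (x + y) - (x + y) ^ l ^ f =
          (shiftI ⟨p, hp0⟩ x - x ^ l ^ f) + (shiftI ⟨p, hp0⟩ y - y ^ l ^ f)
          - (l : 𝓞 K) • (x * y * z.1) := by
        have : shiftI ⟨p, hp0⟩ (x + y) = shiftI ⟨p, hp0⟩ x + shiftI ⟨p, hp0⟩ y := rfl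
        rw [this, hz', smul_fun, map_natCast]; ring
      rw [e]
      exact sub_mem (add_mem hx' hy') (h1 p _ _ hlp (mul_mem (mul_mem ((hAm _).1 hx.1) ((hAm _).1 hy.1)) z.2))
    · intro r
      rw [USet_succ]
      refine ⟨(hAm _).2 (A.algebraMap_mem r), fun p hp hp0 => ?_⟩
      have e : shiftI ⟨p, hp0⟩ (algebraMap (𝓞 K) (NZI (𝓞 K) → Kbar K) r) -
          (algebraMap (𝓞 K) (NZI (𝓞 K) → Kbar K) r) ^ Ideal.absNorm p =
          (r - r ^ Ideal.absNorm p) • (1 : NZI (𝓞 K) → Kbar K) := by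
        have : shiftI ⟨p, hp0⟩ (algebraMap (𝓞 K) (NZI (𝓞 K) → Kbar K) r) =
          algebraMap (𝓞 K) (NZI (𝓞 K) → Kbar K) r := rfl
        rw [this, smul_fun, mul_one, map_sub, map_pow]
      rw [e]
      exact h1 p _ _ ((prime_norm_facts K p hp hp0).2 r) (one_mem A)
    · intro a x hx
      change x ∈ USet K (n+1) at hx
      change shiftI a x ∈ USet K (n+1)
      rw [USet_succ] at hx ⊢
      refine ⟨(hAm _).2 (hsh a _ ((hAm _).1 hx.1)), fun p hp hp0 => ?_⟩
      rw [shiftI_shiftI]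
      exact h3 p _ a (hx.2 p hp hp0)

lemma inv_smul_pSpan (n : ℕ) (p : Ideal (𝓞 K)) (t : K) (ht : ∀ r ∈ p, ∃ r' : 𝓞 K, t * (r : K) = r')
    (u : NZI (𝓞 K) → Kbar K) (hu : u ∈ pSpan K (USet K n) p) : t • u ∈ USet K n := by
  obtain ⟨A, hA, -⟩ := USet_subalgebra K n
  rw [← hA]
  have hAm : ∀ x, x ∈ USet K n ↔ x ∈ A := by intro x; rw [← hA]; rfl
  induction hu using Submodule.span_induction with
  | mem x hx =>
    obtain ⟨r, hr, η, hη, rfl⟩ := hx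
    obtain ⟨r', hr'⟩ := ht r hr
    have : t • r • η = r' • η := by
      rw [smul_K, smul_smul, hr', smul_K]
    rw [this]
    exact subalg_smul K A r' _ ((hAm _).1 hη)
  | zero => rw [smul_zero]; exact zero_mem A
  | add a b _ _ ha hb => rw [smul_add]; exact add_mem ha hb
  | smul r a _ ha =>
    have h := subalg_smul K A r _ ha
    rw [smul_K, smul_comm] at h
    exact h

/-- Induction principle from invertibility of `𝔭`. -/
lemma inv_induction (p : Ideal (𝓞 K)) (hp0 : p ≠ ⊥) (M : AddSubgroup (NZI (𝓞 K) → Kbar K))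
    (u : NZI (𝓞 K) → Kbar K)
    (h : ∀ s ∈ p, ∀ t : K, (∀ r ∈ p, ∃ r' : 𝓞 K, t * (r : K) = r') → s • t • u ∈ M) : u ∈ M := by
  have h1 : (p : FractionalIdeal (nonZeroDivisors (𝓞 K)) K) * (p : FractionalIdeal (nonZeroDivisors (𝓞 K)) K)⁻¹ = 1 :=
    mul_inv_cancel₀ (by simpa using hp0)
  have h2 : ∀ z ∈ (p : FractionalIdeal (nonZeroDivisors (𝓞 K)) K) * (p : FractionalIdeal (nonZeroDivisors (𝓞 K)) K)⁻¹,
      z • u ∈ M := by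
    intro z hz
    refine FractionalIdeal.mul_induction_on hz ?_ ?_
    · intro s hs t ht
      obtain ⟨s, hs', rfl⟩ := (FractionalIdeal.mem_coeIdeal _).mp hs
      rw [FractionalIdeal.mem_inv_iff (by simpa using hp0)] at ht
      rw [mul_smul]
      refine h s hs' t fun r hr => ?_
      obtain ⟨r', hr'⟩ := (FractionalIdeal.mem_one_iff _).mp (ht (algebraMap (𝓞 K) K r) (FractionalIdeal.mem_coeIdeal_of_mem _ hr))
      exact ⟨r', hr'.symm⟩
    · intro x y hx hy
      rw [add_smul]; exact add_mem hx hy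
  have := h2 1 (by rw [h1]; exact FractionalIdeal.one_mem_one _)
  rwa [one_smul] at this


/-- image of `𝔭^k` in `K̄` -/
noncomputable def TT (p : Ideal (𝓞 K)) (k : ℕ) : AddSubgroup (Kbar K) :=
  AddSubgroup.map (algebraMap (𝓞 K) (Kbar K)).toAddMonoidHom (p ^ k).toAddSubgroup

lemma mem_TT (p : Ideal (𝓞 K)) (k : ℕ) (z : Kbar K) :
    z ∈ TT K p k ↔ ∃ r ∈ p ^ k, algebraMap (𝓞 K) (Kbar K) r = z := Iff.rfl

lemma smul_TT (p : Ideal (𝓞 K)) (k : ℕ) (s : 𝓞 K) (hs : s ∈ p) (z : Kbar K) (hz : z ∈ TT K p k) :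
    algebraMap (𝓞 K) (Kbar K) s * z ∈ TT K p (k+1) := by
  obtain ⟨r, hr, rfl⟩ := hz
  refine ⟨s * r, ?_, map_mul (algebraMap (𝓞 K) (Kbar K)) s r⟩
  change s * r ∈ p ^ (k+1)
  rw [pow_succ']
  exact Ideal.mul_mem_mul hs hr

lemma smul_pt' (r : 𝓞 K) (η : NZI (𝓞 K) → Kbar K) (a) :
    (r • η) a = algebraMap (𝓞 K) (Kbar K) r * η a := smul_pt K r η a

lemma USet_int (n : ℕ) (y) (hy : y ∈ USet K n) (a) : IsIntegral (𝓞 K) (y a) := by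
  induction n with
  | zero => exact hy a
  | succ n ih => exact ih ((USet_succ K n y).1 hy).1

lemma USet_coord (n : ℕ) (y) (hy : y ∈ USet K n) (a) (h : y a ∈ Set.range (algebraMap K (Kbar K))) :
    ∃ r : 𝓞 K, algebraMap (𝓞 K) (Kbar K) r = y a := by
  have h1 := USet_int K n y hy a
  obtain ⟨z, hz⟩ := h
  rw [← hz] at h1 ⊢
  have h2 : IsIntegral (𝓞 K) z := (isIntegral_algebraMap_iff (algebraMap K (Kbar K)).injective).1 h1
  obtain ⟨r, hr⟩ := (IsIntegrallyClosed.isIntegral_iff (R := 𝓞 K) (K := K)).1 h2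
  exact ⟨r, by rw [← hr]; rfl⟩

lemma pow_diff (p : Ideal (𝓞 K)) (hp : p.IsPrime) (hp0 : p ≠ ⊥) (k : ℕ) (A B : 𝓞 K)
    (h : A - B ∈ p ^ (k+1)) : A ^ Ideal.absNorm p - B ^ Ideal.absNorm p ∈ p ^ (k+2) := by
  obtain ⟨⟨l, f, hl, hlf, hf, hlp⟩, _⟩ := prime_norm_facts K p hp hp0
  have hqp : ((Ideal.absNorm p : ℕ) : 𝓞 K) ∈ p := by
    rw [hlf, Nat.cast_pow]; exact Ideal.pow_mem_of_mem p hlp f (Nat.pos_of_ne_zero hf)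
  have hAB : A - B ∈ p := Ideal.pow_le_self (by omega) h
  rw [← geom_sum₂_mul, show k + 2 = (k + 1) + 1 from rfl, pow_succ' p (k+1)]
  refine Ideal.mul_mem_mul ?_ h
  rw [← Ideal.Quotient.eq_zero_iff_mem, RingHom.map_geom_sum₂]
  rw [(Ideal.Quotient.eq).2 hAB, geom_sum₂_self, ← map_natCast (Ideal.Quotient.mk p),
    (Ideal.Quotient.eq_zero_iff_mem).2 hqp, zero_mul]

theorem dwork (p : Ideal (𝓞 K)) (hp : p.IsPrime) (P : NZI (𝓞 K)) (hP : P.1 = p) (k : ℕ) :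
    ∀ y ∈ USet K (k+1), (∀ b, y b ∈ Set.range (algebraMap K (Kbar K))) → ∀ a,
      y (P ^ (k+1) * a) - y (P ^ k * a) ∈ TT K p (k+1) := by
  have hp0 : p ≠ ⊥ := hP ▸ P.2
  have hPe : (⟨p, hp0⟩ : NZI (𝓞 K)) = P := Subtype.ext hP.symm
  have hrng : ∀ y : NZI (𝓞 K) → Kbar K, (∀ b, y b ∈ Set.range (algebraMap K (Kbar K))) → ∀ b,
      (shiftI P y - y ^ Ideal.absNorm p) b ∈ Set.range (algebraMap K (Kbar K)) := by
    intro y hy b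
    obtain ⟨z, hz⟩ := hy (P * b)
    obtain ⟨w, hw⟩ := hy b
    refine ⟨z - w ^ Ideal.absNorm p, ?_⟩
    rw [map_sub, map_pow, hz, hw]; rfl
  have hsm : ∀ (t : K) (y : NZI (𝓞 K) → Kbar K), (∀ b, y b ∈ Set.range (algebraMap K (Kbar K))) →
      ∀ b, (t • y) b ∈ Set.range (algebraMap K (Kbar K)) := by
    intro t y hy b
    obtain ⟨w, hw⟩ := hy b
    exact ⟨t * w, by rw [smulK_pt, map_mul, hw]⟩
  induction k with
  | zero =>
    intro y hy hyK a
    rw [USet_succ] at hy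
    have hu := hy.2 p hp hp0
    rw [hPe] at hu
    set u := shiftI P y - y ^ Ideal.absNorm p with hudef
    have h1 : u a ∈ TT K p 1 := by
      refine inv_induction K p hp0 (AddSubgroup.comap (Pi.evalAddMonoidHom (fun _ => Kbar K) a) (TT K p 1)) u ?_
      intro s hs t ht
      change (s • t • u) a ∈ TT K p 1
      rw [smul_pt']
      refine smul_TT K p 0 s hs _ ?_
      obtain ⟨r, hr⟩ := USet_coord K 0 (t • u) (inv_smul_pSpan K 0 p t ht u hu) a
        (hsm t u (hrng y hyK) a)
      exact ⟨r, by simp, hr⟩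
    obtain ⟨r, hr⟩ := USet_coord K 0 y hy.1 a (hyK a)
    have h2 : y a - (y a) ^ Ideal.absNorm p ∈ TT K p 1 := by
      refine ⟨r - r ^ Ideal.absNorm p, ?_, ?_⟩
      · change _ ∈ p ^ 1
        rw [pow_one]; exact (prime_norm_facts K p hp hp0).2 r
      · change algebraMap (𝓞 K) (Kbar K) _ = _
        rw [map_sub, map_pow, hr]
    have h3 := sub_mem h1 h2
    have e : u a = y (P * a) - (y a) ^ Ideal.absNorm p := rfl
    rw [e] at h3
    simpa using h3
  | succ k ih =>
    intro y hy hyK a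
    rw [USet_succ] at hy
    have hu := hy.2 p hp hp0
    rw [hPe] at hu
    set u := shiftI P y - y ^ Ideal.absNorm p with hudef
    have h1 : u (P ^ (k+1) * a) - u (P ^ k * a) ∈ TT K p (k+2) := by
      refine inv_induction K p hp0 (AddSubgroup.comap (Pi.evalAddMonoidHom (fun _ => Kbar K) (P ^ (k+1) * a)
        - Pi.evalAddMonoidHom (fun _ => Kbar K) (P ^ k * a)) (TT K p (k+2))) u ?_
      intro s hs t ht
      change (s • t • u) (P ^ (k+1) * a) - (s • t • u) (P ^ k * a) ∈ TT K p (k+2)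
      rw [smul_pt', smul_pt', ← mul_sub]
      exact smul_TT K p (k+1) s hs _ (ih (t • u) (inv_smul_pSpan K _ p t ht u hu)
        (hsm t u (hrng y hyK)) a)
    obtain ⟨A, hA⟩ := USet_coord K _ y hy.1 (P ^ (k+1) * a) (hyK _)
    obtain ⟨B, hB⟩ := USet_coord K _ y hy.1 (P ^ k * a) (hyK _)
    have h2 : (y (P ^ (k+1) * a)) ^ Ideal.absNorm p - (y (P ^ k * a)) ^ Ideal.absNorm p
        ∈ TT K p (k+2) := by
      obtain ⟨C, hC, hC'⟩ := ih y hy.1 hyK a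
      have : C = A - B := by
        apply FaithfulSMul.algebraMap_injective (𝓞 K) (Kbar K)
        rw [map_sub, hA, hB]; exact hC'
      subst this
      refine ⟨_, pow_diff K p hp hp0 k A B hC, ?_⟩
      change algebraMap (𝓞 K) (Kbar K) _ = _
      rw [map_sub, map_pow, map_pow, hA, hB]
    have h3 := add_mem h1 h2
    have e : ∀ b, u b = y (P * b) - (y b) ^ Ideal.absNorm p := fun b => rfl
    rw [e, e, ← mul_assoc, ← mul_assoc, ← pow_succ', ← pow_succ'] at h3
    convert h3 using 1
    ring

theorem eps_prime (ε : NZI (𝓞 K) → Kbar K) (h01 : ∀ a, ε a = 0 ∨ ε a = 1)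
    (N : 𝓞 K) (hN : N ≠ 0) (hU : ∀ n, N • ε ∈ USet K n) (P d : NZI (𝓞 K)) (hP : P.1.IsPrime)
    (hd : ∀ a, ε (P * d * a) = ε a) (a) : ε (P * a) = ε a := by
  have hj : ∃ j : ℕ, N ∉ P.1 ^ (j+1) := by
    by_contra! h
    have h1 : N ∈ (⨅ i : ℕ, P.1 ^ i) := by
      rw [Ideal.mem_iInf]
      intro i
      exact Ideal.pow_le_pow_right (Nat.le_succ i) (h i)
    rw [Ideal.iInf_pow_eq_bot_of_isDomain _ hP.ne_top] at h1
    exact hN h1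
  obtain ⟨j, hj⟩ := hj
  have key : ∀ a, ε (P ^ (j+1) * a) = ε (P ^ j * a) := by
    intro a
    by_contra hne
    obtain ⟨C, hC, hC'⟩ := dwork K P.1 hP P rfl j (N • ε) (hU _) (by
      intro b
      rw [smul_pt]
      rcases h01 b with h | h <;> rw [h]
      · exact ⟨0, by simp⟩
      · exact ⟨(N : K), by simp⟩) a
    change algebraMap (𝓞 K) (Kbar K) C = _ at hC'
    rw [smul_pt', smul_pt'] at hC'
    apply hj
    rcases h01 (P ^ (j+1) * a) with h | h <;> rcases h01 (P ^ j * a) with h' | h' <;>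
      rw [h, h'] at hC' hne
    · exact absurd rfl hne
    · have : C = -N := by
        apply FaithfulSMul.algebraMap_injective (𝓞 K) (Kbar K)
        rw [hC']; simp
      rw [this] at hC
      simpa using neg_mem hC
    · have : C = N := by
        apply FaithfulSMul.algebraMap_injective (𝓞 K) (Kbar K)
        rw [hC']; simp
      rwa [this] at hC
    · exact absurd rfl hne
  have hpow : ∀ (i : ℕ) (a), ε ((P * d) ^ i * a) = ε a := by
    intro i
    induction i with
    | zero => intro a; simp
    | succ i ih => intro a; rw [pow_succ', mul_assoc, hd, ih]
  calc ε (P * a) = ε ((P * d) ^ j * (P * a)) := (hpow j _).symm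
    _ = ε (P ^ (j+1) * (d ^ j * a)) := by
      congr 1; rw [mul_pow, pow_succ]; simp only [mul_assoc, mul_left_comm, mul_comm]
    _ = ε (P ^ j * (d ^ j * a)) := key _
    _ = ε ((P * d) ^ j * a) := by rw [mul_pow, mul_assoc]
    _ = ε a := hpow j a

theorem eps_all (ε : NZI (𝓞 K) → Kbar K) (h01 : ∀ a, ε a = 0 ∨ ε a = 1)
    (N : 𝓞 K) (hN : N ≠ 0) (hU : ∀ n, N • ε ∈ USet K n) (c : Ideal (𝓞 K)) :
    ∀ (C d : NZI (𝓞 K)), C.1 = c → (∀ a, ε (C * d * a) = ε a) → ∀ a, ε (C * a) = ε a := by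
  induction c using UniqueFactorizationMonoid.induction_on_prime with
  | h₁ => intro C d hC; exact absurd hC C.2
  | h₂ x hx =>
    intro C d hC hd a
    have : C = 1 := by
      apply Subtype.ext; rw [hC]; exact (Ideal.isUnit_iff.1 hx).trans Ideal.one_eq_top.symm
    rw [this, one_mul]
  | h₃ x p hx hp ih =>
    intro C d hC hd a
    let P : NZI (𝓞 K) := ⟨p, hp.ne_zero⟩
    let X : NZI (𝓞 K) := ⟨x, hx⟩
    have hPX : C = P * X := Subtype.ext hC
    subst hPX
    have h1 := eps_prime K ε h01 N hN hU P (X * d) (Ideal.isPrime_of_prime hp)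
      (by intro a; rw [← hd a, mul_assoc P X d])
    have h2 := ih X (P * d) rfl (by intro a; rw [← hd a]; congr 1; simp only [mul_assoc, mul_left_comm, mul_comm])
    rw [mul_assoc, h1, h2]


lemma shift_mem_XXi (ξ : NZI (𝓞 K) → Kbar K) (a : NZI (𝓞 K)) : shiftI a ξ ∈ XXi K {ξ} :=
  Algebra.subset_adjoin ⟨a, ξ, rfl, rfl⟩

/-- the shift as algebra hom -/
def shiftHom (a : NZI (𝓞 K)) : (NZI (𝓞 K) → Kbar K) →ₐ[K] (NZI (𝓞 K) → Kbar K) where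
  toFun := shiftI a
  map_one' := rfl
  map_mul' _ _ := rfl
  map_zero' := rfl
  map_add' _ _ := rfl
  commutes' _ := rfl

lemma shift_congr (ξ : NZI (𝓞 K) → Kbar K) (a b : NZI (𝓞 K)) (h : shiftI a ξ = shiftI b ξ) :
    ∀ x ∈ XXi K {ξ}, shiftI a x = shiftI b x := by
  intro x hx
  have : XXi K {ξ} ≤ AlgHom.equalizer (shiftHom K a) (shiftHom K b) := by
    refine Algebra.adjoin_le ?_
    rintro y ⟨c, _, rfl, rfl⟩
    change shiftI a (shiftI c _) = shiftI b (shiftI c _)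
    rw [shiftI_shiftI, h, shiftI_shiftI]
  exact this hx

lemma shift_XXi (ξ : NZI (𝓞 K) → Kbar K) (a : NZI (𝓞 K)) :
    ∀ x ∈ XXi K {ξ}, shiftI a x ∈ XXi K {ξ} := by
  intro x hx
  have : XXi K {ξ} ≤ (XXi K {ξ}).comap (shiftHom K a) := by
    refine Algebra.adjoin_le ?_
    rintro y ⟨c, z, hz, rfl⟩
    rw [Set.mem_singleton_iff.1 hz]
    have : shiftI a (shiftI c ξ) = shiftI (a * c) ξ := by
      funext d; simp only [shiftI]; rw [← mul_assoc, mul_comm c a]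
    change shiftI a (shiftI c ξ) ∈ XXi K {ξ}
    rw [this]; exact shift_mem_XXi K _ _
  exact this hx

lemma XXi_denom (ξ : NZI (𝓞 K) → Kbar K) (hξ : ξ ∈ WittA K) (x) (hx : x ∈ XXi K {ξ}) :
    ∃ N : 𝓞 K, N ≠ 0 ∧ ∀ n, N • x ∈ USet K n := by
  choose A hA hsh using USet_subalgebra K
  have hAm : ∀ n x, x ∈ USet K n ↔ x ∈ A n := by intro n x; rw [← hA]; rfl
  simp only [hAm]
  induction hx using Algebra.adjoin_induction with
  | mem x hx =>
    obtain ⟨a, _, rfl, rfl⟩ := hx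
    refine ⟨1, one_ne_zero, fun n => subalg_smul K _ _ _ (hsh _ _ _ ((hAm _ _).1 (hξ.1 n)))⟩
  | algebraMap r =>
    obtain ⟨a, b, hb, hab⟩ := IsFractionRing.div_surjective (A := 𝓞 K) r
    have hb0 : b ≠ 0 := nonZeroDivisors.ne_zero hb
    refine ⟨b, hb0, fun n => ?_⟩
    have : b • algebraMap K (NZI (𝓞 K) → Kbar K) r = algebraMap (𝓞 K) (NZI (𝓞 K) → Kbar K) a := by
      funext c
      rw [smul_pt]
      change algebraMap K (Kbar K) _ * algebraMap K (Kbar K) r = algebraMap K (Kbar K) (algebraMap (𝓞 K) K a)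
      rw [← map_mul, ← hab]
      congr 1
      have : algebraMap (𝓞 K) K b ≠ 0 := by simpa using hb0
      field_simp
    rw [this]; exact (A n).algebraMap_mem a
  | add x y _ _ hx hy =>
    obtain ⟨N, hN, hx⟩ := hx
    obtain ⟨M, hM, hy⟩ := hy
    refine ⟨N * M, mul_ne_zero hN hM, fun n => ?_⟩
    have : (N * M) • (x + y) = M • (N • x) + N • (M • y) := by
      simp only [smul_fun, map_mul]; ring
    rw [this]
    exact add_mem (subalg_smul K _ _ _ (hx n)) (subalg_smul K _ _ _ (hy n))
  | mul x y _ _ hx hy =>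
    obtain ⟨N, hN, hx⟩ := hx
    obtain ⟨M, hM, hy⟩ := hy
    refine ⟨N * M, mul_ne_zero hN hM, fun n => ?_⟩
    have : (N * M) • (x * y) = (N • x) * (M • y) := by
      simp only [smul_fun, map_mul]; ring
    rw [this]
    exact mul_mem (hx n) (hy n)

lemma XXi_integral (ξ : NZI (𝓞 K) → Kbar K) (hξ : ξ ∈ WittA K) (x) (hx : x ∈ XXi K {ξ}) :
    IsIntegral K x := by
  have h0 : IsIntegral K ξ := hξ.2.tower_top
  have : XXi K {ξ} ≤ integralClosure K (NZI (𝓞 K) → Kbar K) := by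
    refine Algebra.adjoin_le ?_
    rintro y ⟨c, _, rfl, rfl⟩
    exact h0.map (shiftHom K c)
  exact this hx

open Polynomial in
lemma XXi_eps (ξ : NZI (𝓞 K) → Kbar K) (hξ : ξ ∈ WittA K) (x) (hx : x ∈ XXi K {ξ}) :
    ∃ ε ∈ XXi K {ξ}, ∀ c, (x c = 0 → ε c = 0) ∧ (x c ≠ 0 → ε c = 1) := by
  obtain ⟨f, hf, hfx⟩ := XXi_integral K ξ hξ x hx
  obtain ⟨h, hfh, hXh⟩ := Polynomial.exists_eq_pow_rootMultiplicity_mul_and_not_dvd f hf.ne_zero 0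
  rw [map_zero, sub_zero] at hfh hXh
  have hh0 : h.eval 0 ≠ 0 := by
    rw [← Polynomial.coeff_zero_eq_eval_zero]; rwa [Polynomial.X_dvd_iff] at hXh
  refine ⟨1 - (h.eval 0)⁻¹ • aeval x h, ?_, ?_⟩
  · refine sub_mem (one_mem _) (Subalgebra.smul_mem _ ?_ _)
    exact Algebra.adjoin_le (Set.singleton_subset_iff.2 hx) (aeval_mem_adjoin_singleton K x)
  · intro c
    have he : ∀ g : K[X], (aeval x g) c = aeval (x c) g := fun g =>
      (Polynomial.aeval_algHom_apply (Pi.evalAlgHom K (fun _ => Kbar K) c) x g).symm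
    have hc : (1 - (h.eval 0)⁻¹ • aeval x h : NZI (𝓞 K) → Kbar K) c =
        1 - algebraMap K (Kbar K) (h.eval 0)⁻¹ * aeval (x c) h := by
      rw [Pi.sub_apply, smulK_pt, he]; rfl
    rw [hc]
    constructor
    · intro h0
      rw [h0, Polynomial.aeval_def, Polynomial.eval₂_at_zero, ← map_mul, Polynomial.coeff_zero_eq_eval_zero,
        inv_mul_cancel₀ hh0]
      simp
    · intro h0
      have h1 : aeval (x c) f = 0 := by
        rw [← he]
        have : aeval x f = 0 := hfx
        rw [this]; rfl
      rw [hfh, map_mul, map_pow, aeval_X, mul_eq_zero] at h1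
      rcases h1 with h1 | h1
      · exact absurd h1 (pow_ne_zero _ h0)
      · rw [h1]; simp

theorem JEquiv_ker (ξ : NZI (𝓞 K) → Kbar K) (hξ : ξ ∈ WittA K) (a b : NZI (𝓞 K))
    (hab : JEquiv K ξ a b) (x) (hx : x ∈ XXi K {ξ}) : x a = 0 ↔ x b = 0 := by
  obtain ⟨ε, hε, hεx⟩ := XXi_eps K ξ hξ x hx
  have h01 : ∀ c, ε c = 0 ∨ ε c = 1 := fun c => by
    by_cases h : x c = 0
    · exact Or.inl ((hεx c).1 h)
    · exact Or.inr ((hεx c).2 h)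
  have hz : ∀ c, x c = 0 ↔ ε c = 0 := fun c => by
    constructor
    · exact (hεx c).1
    · intro h; by_contra h'; rw [(hεx c).2 h'] at h; exact one_ne_zero h
  obtain ⟨⟨c, hc⟩, ⟨d, hd⟩⟩ := hab
  have hc' := shift_congr K ξ _ _ hc ε hε
  have hd' := shift_congr K ξ _ _ hd ε hε
  have hη := shift_XXi K ξ a ε hε
  obtain ⟨N, hN, hU⟩ := XXi_denom K ξ hξ _ hη
  have hh : ∀ e, ε (b * c * e) = ε (a * e) := fun e => congrFun hc' e
  have hh' : ∀ e, ε (a * d * e) = ε (b * e) := fun e => congrFun hd' e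
  have := eps_all K (shiftI a ε) (fun e => h01 _) N hN hU d.1 d c rfl (by
    intro e
    simp only [shiftI]
    rw [mul_assoc d c e, ← mul_assoc a d, hh', ← mul_assoc b c, hh]) 1
  simp only [shiftI] at this
  rw [← mul_assoc, hh', mul_one, mul_one] at this
  rw [hz, hz, this]


lemma prod_offDiag_mem {S : Type*} [CommRing S] [DecidableEq S] (R : Finset S) (Q : Ideal S)
    (x y : S) (hx : x ∈ R) (hy : y ∈ R) (hne : x ≠ y) (h : x - y ∈ Q) :
    ∏ z ∈ R.offDiag, (z.1 - z.2) ∈ Q :=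
  Ideal.mem_of_dvd _ (Finset.dvd_prod_of_mem (fun z : S × S => z.1 - z.2)
    (Finset.mem_offDiag.2 ⟨hx, hy, hne⟩ : (x, y) ∈ R.offDiag)) h

open Polynomial in
theorem gal_shift (L : Type*) [Field L] [NumberField L] [Algebra K L] [IsGalois K L]
    (v : NZI (𝓞 K) → 𝓞 L) (f : (𝓞 K)[X]) (hf : f.Monic) (hv : ∀ c, aeval (v c) f = 0)
    (hfr : ∀ (Q : Ideal (𝓞 L)), Q.IsPrime → Q ≠ ⊥ → ∀ P : NZI (𝓞 K), P.1 = Q.under (𝓞 K) →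
      ∀ d, v (P * d) - v d ^ (Nat.card (𝓞 K ⧸ Q.under (𝓞 K))) ∈ Q) (τ : L ≃ₐ[K] L) :
    ∃ c, ∀ d, τ • v d = v (c * d) := by
  classical
  let H : Subgroup (L ≃ₐ[K] L) :=
    { carrier := {τ | ∃ c, ∀ d, τ • v d = v (c * d)}
      mul_mem' := by
        rintro σ τ ⟨c, hc⟩ ⟨e, he⟩
        exact ⟨c * e, fun d => by rw [mul_smul, he, hc, mul_assoc]⟩
      one_mem' := ⟨1, fun d => by rw [one_smul, one_mul]⟩
      inv_mem' := by
        rintro τ ⟨c, hc⟩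
        have hk : ∀ (k : ℕ) d, (τ ^ k) • v d = v (c ^ k * d) := by
          intro k
          induction k with
          | zero => intro d; simp
          | succ k ih => intro d; rw [pow_succ, mul_smul, hc, ih, pow_succ, mul_assoc]
        have : τ⁻¹ = τ ^ (orderOf τ - 1) := by
          rw [inv_eq_iff_mul_eq_one, ← pow_succ', Nat.sub_add_cancel (orderOf_pos τ), pow_orderOf_eq_one]
        exact ⟨c ^ (orderOf τ - 1), fun d => by rw [this, hk]⟩ }
  let R : Finset (𝓞 L) := (f.map (algebraMap (𝓞 K) (𝓞 L))).roots.toFinset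
  have hR : ∀ x, x ∈ R ↔ aeval x f = 0 := by
    intro x
    rw [Multiset.mem_toFinset, mem_roots (hf.map _).ne_zero, IsRoot.def, eval_map_algebraMap]
  have hH : H = ⊤ := by
    refine frob_generate K L H (∏ z ∈ R.offDiag, (z.1 - z.2)) ?_ ?_
    · rw [Finset.prod_ne_zero_iff]
      intro z hz
      exact sub_ne_zero.2 (Finset.mem_offDiag.1 hz).2.2
    · intro Q hQ hQ0 hδ σ hσ
      have hp0 : Q.under (𝓞 K) ≠ ⊥ := Ideal.under_ne_bot (𝓞 K) hQ0
      refine ⟨⟨Q.under (𝓞 K), hp0⟩, fun d => ?_⟩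
      by_contra hne
      apply hδ
      have h1 : σ • v d ∈ R := by
        rw [hR]
        have : aeval (σ • v d) f = σ • aeval (v d) f := by
          exact Polynomial.aeval_algHom_apply (MulSemiringAction.toAlgHom (𝓞 K) (𝓞 L) σ) (v d) f
        rw [this, hv, smul_zero]
      have h2 : v (⟨Q.under (𝓞 K), hp0⟩ * d) ∈ R := (hR _).2 (hv _)
      refine prod_offDiag_mem R Q _ _ h1 h2 hne ?_
      have h3 := sub_mem (hσ (v d)) (hfr Q hQ hQ0 ⟨Q.under (𝓞 K), hp0⟩ rfl d)
      simpa using h3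
  have : τ ∈ H := hH ▸ Subgroup.mem_top τ
  exact this


lemma frob_congr (ξ : NZI (𝓞 K) → Kbar K) (hξ : ξ ∈ WittA K) (L : IntermediateField K (Kbar K))
    [NumberField L] (hL : ∀ c, ξ c ∈ L) (v : NZI (𝓞 K) → 𝓞 L) (hv : ∀ c, ((v c : L) : Kbar K) = ξ c)
    (Q : Ideal (𝓞 L)) (hQ : Q.IsPrime) (hQ0 : Q ≠ ⊥) (P : NZI (𝓞 K)) (hP : P.1 = Q.under (𝓞 K)) (d) :
    v (P * d) - v d ^ (Nat.card (𝓞 K ⧸ Q.under (𝓞 K))) ∈ Q := by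
  have hpp : P.1.IsPrime := by rw [hP]; infer_instance
  have hq : Ideal.absNorm P.1 = Nat.card (𝓞 K ⧸ Q.under (𝓞 K)) := by
    rw [Ideal.absNorm_apply, Submodule.cardQuot_apply, hP]
  rw [← hq]
  have hu := ((USet_succ K 0 ξ).1 (hξ.1 1)).2 P.1 hpp P.2
  set u := shiftI ⟨P.1, P.2⟩ ξ - ξ ^ Ideal.absNorm P.1 with hudef
  let j : 𝓞 L →+* Kbar K := (algebraMap L (Kbar K)).comp (algebraMap (𝓞 L) L)
  have hj : Function.Injective j :=
    (algebraMap L (Kbar K)).injective.comp RingOfIntegers.coe_injective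
  let T : AddSubgroup (Kbar K) := AddSubgroup.map j.toAddMonoidHom Q.toAddSubgroup
  have hud : u d = j (v (P * d) - v d ^ Ideal.absNorm P.1) := by
    rw [map_sub, map_pow]
    change ξ (P * d) - ξ d ^ _ = ((v (P * d) : L) : Kbar K) - ((v d : L) : Kbar K) ^ _
    rw [hv, hv]
  have h1 : u d ∈ T := by
    refine inv_induction K P.1 P.2 (AddSubgroup.comap (Pi.evalAddMonoidHom (fun _ => Kbar K) d) T) u ?_
    intro s hs t ht
    change (s • t • u) d ∈ T
    have hint : IsIntegral (𝓞 K) ((t • u) d) := USet_int K 0 _ (inv_smul_pSpan K 0 P.1 t ht u hu) d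
    have hint' : IsIntegral ℤ ((t • u) d) := isIntegral_trans (R := ℤ) (A := 𝓞 K) _ hint
    have hmem : (t • u) d ∈ L := by
      rw [smulK_pt, hud]
      exact mul_mem (L.algebraMap_mem t) (SetLike.coe_mem _)
    have hint2 : IsIntegral ℤ (⟨_, hmem⟩ : L) :=
      (isIntegral_algebraMap_iff (B := Kbar K) (algebraMap L (Kbar K)).injective).1 hint'
    refine ⟨algebraMap (𝓞 K) (𝓞 L) s * ⟨⟨_, hmem⟩, hint2⟩, ?_, ?_⟩
    · apply Ideal.mul_mem_right
      rw [hP] at hs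
      exact hs
    · rw [smul_pt']
      rfl
  obtain ⟨w, hw, hwu⟩ := h1
  have : w = v (P * d) - v d ^ Ideal.absNorm P.1 := hj (hwu.trans hud)
  exact this ▸ hw

open Polynomial in
theorem gal_witt (ξ : NZI (𝓞 K) → Kbar K) (hξ : ξ ∈ WittA K) :
    ∃ L : IntermediateField K (Kbar K), Normal K L ∧ (∀ c, ξ c ∈ L) ∧
      ∀ τ : L ≃ₐ[K] L, ∃ c, ∀ d, ∀ x : L, (x : Kbar K) = ξ d → (τ x : Kbar K) = ξ (c * d) := by
  obtain ⟨f, hf, hfξ⟩ := hξ.2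
  have hroot : ∀ c, aeval (ξ c) f = 0 := by
    intro c
    have := Polynomial.aeval_algHom_apply (Pi.evalAlgHom (𝓞 K) (fun _ => Kbar K) c) ξ f
    have h0 : aeval ξ f = 0 := hfξ
    rw [h0, map_zero] at this
    exact this
  let g : K[X] := f.map (algebraMap (𝓞 K) K)
  have hg : g ≠ 0 := (hf.map _).ne_zero
  let L := IntermediateField.adjoin K (g.rootSet (Kbar K))
  have hs : g.IsSplittingField K L :=
    IntermediateField.adjoin_rootSet_isSplittingField (IsAlgClosed.splits _)
  have : FiniteDimensional K L := IsSplittingField.finiteDimensional L g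
  have hn : Normal K L := Normal.of_isSplittingField g
  have : NumberField L := NumberField.of_module_finite K L
  have : IsGalois K L := ⟨⟩
  have hL : ∀ c, ξ c ∈ L := by
    intro c
    apply IntermediateField.subset_adjoin
    rw [mem_rootSet]
    refine ⟨hg, ?_⟩
    rw [aeval_map_algebraMap]; exact hroot c
  have hint : ∀ c, IsIntegral ℤ (⟨ξ c, hL c⟩ : L) := by
    intro c
    refine (isIntegral_algebraMap_iff (B := Kbar K) (algebraMap L (Kbar K)).injective).1 ?_
    exact isIntegral_trans (R := ℤ) (A := 𝓞 K) _ ⟨f, hf, hroot c⟩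
  let v : NZI (𝓞 K) → 𝓞 L := fun c => ⟨⟨ξ c, hL c⟩, hint c⟩
  have hv : ∀ c, ((v c : L) : Kbar K) = ξ c := fun c => rfl
  refine ⟨L, hn, hL, fun τ => ?_⟩
  have h1 : ∀ c, aeval (v c) f = 0 := by
    intro c
    have hj : Function.Injective (algebraMap (𝓞 L) (Kbar K)) :=
      (algebraMap L (Kbar K)).injective.comp RingOfIntegers.coe_injective
    apply hj
    rw [map_zero, aeval_def, hom_eval₂]
    exact hroot c
  obtain ⟨c, hc⟩ := gal_shift K L v f hf h1
    (fun Q hQ hQ0 P hP d => frob_congr K ξ hξ L hL v hv Q hQ hQ0 P hP d) τ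
  refine ⟨c, fun d x hx => ?_⟩
  have hx' : x = (v d : L) := Subtype.ext (hx.trans (hv d).symm)
  rw [hx', ← hv, ← hc d]
  rfl


lemma XXi_eval_mem (ξ : NZI (𝓞 K) → Kbar K) (b : NZI (𝓞 K)) (x) (hx : x ∈ XXi K {ξ}) :
    x b ∈ IntermediateField.adjoin K (Set.range fun d : NZI (𝓞 K) => ξ (b * d)) := by
  have : XXi K {ξ} ≤ (IntermediateField.adjoin K
      (Set.range fun d : NZI (𝓞 K) => ξ (b * d))).toSubalgebra.comap
      (Pi.evalAlgHom K (fun _ => Kbar K) b) := by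
    refine Algebra.adjoin_le ?_
    rintro y ⟨c, z, hz, rfl⟩
    rw [Set.mem_singleton_iff.1 hz]
    refine IntermediateField.subset_adjoin K _ ⟨c, ?_⟩
    change ξ (b * c) = ξ (c * b)
    rw [mul_comm]
  exact this hx

/-- evaluation map -/
noncomputable def evX (ξ : NZI (𝓞 K) → Kbar K) (b : NZI (𝓞 K)) : (XXi K {ξ}) →ₐ[K]
    IntermediateField.adjoin K (Set.range fun d : NZI (𝓞 K) => ξ (b * d)) :=
  AlgHom.codRestrict ((Pi.evalAlgHom K (fun _ => Kbar K) b).comp (XXi K {ξ}).val)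
    (IntermediateField.adjoin K (Set.range fun d : NZI (𝓞 K) => ξ (b * d))).toSubalgebra
    (fun x => XXi_eval_mem K ξ b x.1 x.2)

lemma evX_coe (ξ : NZI (𝓞 K) → Kbar K) (b : NZI (𝓞 K)) (x : XXi K {ξ}) :
    ((evX K ξ b x : _) : Kbar K) = x.1 b := rfl

lemma evX_zero (ξ : NZI (𝓞 K) → Kbar K) (b : NZI (𝓞 K)) (x : XXi K {ξ}) :
    evX K ξ b x = 0 ↔ x.1 b = 0 := by
  rw [← evX_coe]; exact ZeroMemClass.coe_eq_zero.symm

lemma evX_surj (ξ : NZI (𝓞 K) → Kbar K) (b : NZI (𝓞 K)) : Function.Surjective (evX K ξ b) := by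
  rintro ⟨y, hy⟩
  have hy' : y ∈ (IntermediateField.adjoin K
      (Set.range fun d : NZI (𝓞 K) => ξ (b * d))).toSubalgebra := hy
  rw [IntermediateField.adjoin_toSubalgebra] at hy'
  have : Algebra.adjoin K (Set.range fun d : NZI (𝓞 K) => ξ (b * d)) ≤
      ((Pi.evalAlgHom K (fun _ => Kbar K) b).comp (XXi K {ξ}).val).range := by
    refine Algebra.adjoin_le ?_
    rintro _ ⟨d, rfl⟩
    refine ⟨⟨shiftI d ξ, shift_mem_XXi K ξ d⟩, ?_⟩
    change ξ (d * b) = ξ (b * d)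
    rw [mul_comm]
  obtain ⟨x, hx⟩ := this hy'
  exact ⟨x, Subtype.ext hx⟩

theorem ker_JBelow (ξ : NZI (𝓞 K) → Kbar K) (hξ : ξ ∈ WittA K) (a b : NZI (𝓞 K))
    (h : ∀ x ∈ XXi K {ξ}, x a = 0 → x b = 0) : JBelow K ξ b a := by
  let F := IntermediateField.adjoin K (Set.range fun d : NZI (𝓞 K) => ξ (a * d))
  let eb : (XXi K {ξ}) →ₐ[K] Kbar K := (Pi.evalAlgHom K (fun _ => Kbar K) b).comp (XXi K {ξ}).val
  have hker : RingHom.ker (evX K ξ a) ≤ RingHom.ker eb := by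
    intro x hx
    rw [RingHom.mem_ker] at hx ⊢
    exact h x.1 x.2 ((evX_zero K ξ a x).1 hx)
  let φ : F →ₐ[K] Kbar K := AlgHom.liftOfSurjective (evX K ξ a) (evX_surj K ξ a) eb hker
  have hφ : ∀ x, φ (evX K ξ a x) = eb x := fun x => AlgHom.liftOfSurjective_apply _ _ _ _ x
  obtain ⟨σ, hσ⟩ := IsAlgClosed.surjective_domRestrict_of_isAlgebraic (K := K) (L := F) (M := Kbar K) (E := Kbar K) φ
  have hσ' : ∀ x : F, σ (x : Kbar K) = φ x := fun x => DFunLike.congr_fun hσ x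
  have key : ∀ d, σ (ξ (a * d)) = ξ (b * d) := by
    intro d
    have h1 := hφ ⟨shiftI d ξ, shift_mem_XXi K ξ d⟩
    rw [← hσ', evX_coe] at h1
    change σ (ξ (d * a)) = ξ (d * b) at h1
    rwa [mul_comm a, mul_comm b]
  obtain ⟨L, hn, hL, hG⟩ := gal_witt K ξ hξ
  obtain ⟨c, hc⟩ := hG (σ.restrictNormal' L)
  refine ⟨c, ?_⟩
  funext d
  have h2 := hc (a * d) ⟨_, hL (a * d)⟩ rfl
  have h3 : ((σ.restrictNormal' L ⟨_, hL (a * d)⟩ : L) : Kbar K) = σ (ξ (a * d)) :=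
    AlgHom.restrictNormal_commutes σ L ⟨_, hL (a * d)⟩
  change ξ (a * c * d) = ξ (b * d)
  rw [← key, ← h3, h2, ← mul_assoc, mul_comm a c]

theorem main_aux
    (ξ : NZI (𝓞 K) → Kbar K) (hξ : ξ ∈ WittA K)
    (r : ℕ) (𝔞 : Fin r → NZI (𝓞 K))
    (hrep : ∀ b : NZI (𝓞 K), ∃! i : Fin r, JEquiv K ξ b (𝔞 i)) :
    Nonempty ((XXi K {ξ}) ≃ₐ[K]
      ∀ i : Fin r,
        IntermediateField.adjoin K (Set.range fun b : NZI (𝓞 K) => ξ (𝔞 i * b))) := by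
  let Φ := AlgHom.pi (fun i => evX K ξ (𝔞 i))
  refine ⟨AlgEquiv.ofBijective Φ ⟨?_, ?_⟩⟩
  · rw [injective_iff_map_eq_zero]
    intro x hx
    apply Subtype.ext
    funext b
    obtain ⟨i, hi, -⟩ := hrep b
    have := (evX_zero K ξ (𝔞 i) x).1 (congrFun hx i)
    exact (JEquiv_ker K ξ hξ b (𝔞 i) hi x.1 x.2).2 this
  · intro y
    have hmax : ∀ i, (RingHom.ker (evX K ξ (𝔞 i))).IsMaximal := fun i =>
      RingHom.ker_isMaximal_of_surjective _ (evX_surj K ξ (𝔞 i))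
    have hcop : Pairwise (Function.onFun IsCoprime fun i => RingHom.ker (evX K ξ (𝔞 i))) := by
      intro i j hij
      refine (Ideal.isCoprime_iff_sup_eq).2 (Ideal.IsMaximal.coprime_of_ne (hmax i) (hmax j) ?_)
      intro hk
      beta_reduce at hk
      apply hij
      have hz : ∀ x ∈ XXi K {ξ}, x (𝔞 i) = 0 ↔ x (𝔞 j) = 0 := by
        intro x hx
        rw [← evX_zero K ξ (𝔞 i) ⟨x, hx⟩, ← evX_zero K ξ (𝔞 j) ⟨x, hx⟩, ← RingHom.mem_ker, ← RingHom.mem_ker, hk]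
      have hJ : JEquiv K ξ (𝔞 i) (𝔞 j) :=
        ⟨ker_JBelow K ξ hξ (𝔞 j) (𝔞 i) (fun x hx => (hz x hx).2),
          ker_JBelow K ξ hξ (𝔞 i) (𝔞 j) (fun x hx => (hz x hx).1)⟩
      have hI : JEquiv K ξ (𝔞 i) (𝔞 i) := ⟨⟨1, by rw [mul_one]⟩, ⟨1, by rw [mul_one]⟩⟩
      exact (hrep (𝔞 i)).unique hI hJ
    choose x hx using fun i => evX_surj K ξ (𝔞 i) (y i)
    obtain ⟨z, hz⟩ := Ideal.exists_forall_sub_mem_ideal hcop x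
    refine ⟨z, funext fun i => ?_⟩
    have := hz i
    rw [RingHom.mem_ker, map_sub, sub_eq_zero, hx] at this
    exact this

/-- Let `ξ ∈ W^a_{O_K}(O_K̄)` and let `𝔞_1, …, 𝔞_r ∈ I_K` be a set of
representatives of the `𝒥`-classes of the finite commutative monoid `M_ξ = I_K/≡_ξ`
(each ideal is `𝒥`-equivalent to exactly one `𝔞_i`). Then there is a `K`-algebra
isomorphism `X_ξ ≅ ∏_{i=1}^r K(ξ_{𝔞_i 𝔟} : 𝔟 ∈ I_K)`, where `K(ξ_{𝔞_i 𝔟} : 𝔟 ∈ I_K)` is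
the intermediate field of `K̄/K` generated by the coefficients `ξ_{𝔞_i 𝔟}`. -/
theorem XXi_single_iso_prod_fields
    (ξ : NZI (𝓞 K) → Kbar K) (hξ : ξ ∈ WittA K)
    (r : ℕ) (𝔞 : Fin r → NZI (𝓞 K))
    (hrep : ∀ b : NZI (𝓞 K), ∃! i : Fin r, JEquiv K ξ b (𝔞 i)) :
    Nonempty ((XXi K {ξ}) ≃ₐ[K]
      ∀ i : Fin r,
        IntermediateField.adjoin K (Set.range fun b : NZI (𝓞 K) => ξ (𝔞 i * b))) := by
  exact main_aux K ξ hξ r 𝔞 hrep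
end

section
/- Let Ξ ⊆ W^a_{O_K}(O_K̄) be a finite set of integral Witt vectors. A deterministic finite automaton 𝔄 over the alphabet P_K consists of a finite state set S, a transition map δ : S × P_K → S (extended to words δ* : S × P_K* → S) and an initial state s_0 ∈ S; say 𝔄 generates Ξ if for every ξ ∈ Ξ there exists an output function τ : S → O_K̄ such that for every finite word w = 𝔭_1⋯𝔭_n over P_K (including the empty word) one has ξ_{𝔭_1⋯𝔭_n} = τ(δ*(s_0, w)), where 𝔭_1⋯𝔭_n ∈ I_K is the product ideal (the empty word giving the unit ideal). The state complexity c_Ξ is the minimum of |S| over all DFAs 𝔄 generating Ξ. Then c_Ξ = dim_K X_Ξ, the dimension of X_Ξ as a K-vector space. In particular c_ξ = dim_K X_ξ for every single integral Witt vector ξ. -/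
open NumberField

set_option synthInstance.maxHeartbeats 1000000
set_option maxHeartbeats 1000000

variable (K : Type*) [Field K] [NumberField K]

/-- A deterministic finite automaton over the alphabet `P_K` of nonzero primes of `O_K`:
a finite state set `S`, a transition map `δ`, and an initial state `s₀`. -/
structure WittDFA where
  S : Type
  [fin : Finite S]
  δ : S → {p : Ideal (𝓞 K) // p.IsPrime ∧ p ≠ ⊥} → S
  s0 : S

/-- The ideal of `O_K` obtained as the product of the letters of a word over `P_K`
(the empty word giving the unit ideal). -/
def wordProd (w : List {p : Ideal (𝓞 K) // p.IsPrime ∧ p ≠ ⊥}) : NZI (𝓞 K) :=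
  (w.map fun p => (⟨p.1, p.2.2⟩ : NZI (𝓞 K))).prod

/-- The DFA `𝔄` generates `Ξ` if for every `ξ ∈ Ξ` there is an output function
`τ : S → O_K̄` such that `ξ_{𝔭_1⋯𝔭_n} = τ(δ*(s₀, 𝔭_1⋯𝔭_n))` for every word. -/
def Generates (𝔄 : WittDFA K) (Ξ : Set (NZI (𝓞 K) → Kbar K)) : Prop :=
  ∀ ξ ∈ Ξ, ∃ τ : 𝔄.S → Kbar K, (∀ s, IsIntegral (𝓞 K) (τ s)) ∧
    ∀ w : List {p : Ideal (𝓞 K) // p.IsPrime ∧ p ≠ ⊥},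
      ξ (wordProd K w) = τ (w.foldl 𝔄.δ 𝔄.s0)

/-- The state complexity `c_Ξ`: the minimal number of states of a DFA generating `Ξ`. -/
noncomputable def stateComplexity (Ξ : Set (NZI (𝓞 K) → Kbar K)) : ℕ :=
  sInf {n : ℕ | ∃ 𝔄 : WittDFA K, Generates K 𝔄 Ξ ∧ Nat.card 𝔄.S = n}


namespace WDFA
open Filter Topology

noncomputable def wt {R : Type*} [CommRing R] [IsDedekindDomain R] [Module.Free ℤ R] (s : ℝ) (I : Ideal R) : ENNReal :=
  ENNReal.ofReal ((Ideal.absNorm I : ℝ) ^ (-s))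

lemma wt_mul {R : Type*} [CommRing R] [IsDedekindDomain R] [Module.Free ℤ R] (s : ℝ) (I J : Ideal R) :
    wt s (I * J) = wt s I * wt s J := by
  unfold wt
  rw [← ENNReal.ofReal_mul (by positivity), map_mul, Nat.cast_mul, Real.mul_rpow (by positivity) (by positivity)]

lemma tsum_wt (F : Type*) [Field F] [NumberField F] (s : ℝ) (hs : 1 < s) (h0 : dedekindZeta F s ≠ 0) :
    (∑' I : Ideal (𝓞 F), wt s I) = ENNReal.ofReal ‖dedekindZeta F s‖ := by
  set c : ℕ → ℕ := fun n => Nat.card {I : Ideal (𝓞 F) // Ideal.absNorm I = n} with hc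
  have hsum : Summable (fun n => LSeries.term (fun n ↦ (c n : ℂ)) s n) := by
    by_contra h
    exact h0 (tsum_eq_zero_of_not_summable h)
  have hterm : ∀ n, LSeries.term (fun n ↦ (c n : ℂ)) s n = (((c n : ℝ) * (n : ℝ) ^ (-s) : ℝ) : ℂ) := by
    intro n
    rcases Nat.eq_zero_or_pos n with rfl | hn
    · simp [Real.zero_rpow (show -s ≠ 0 by linarith)]
    · rw [LSeries.term_of_ne_zero hn.ne', Real.rpow_neg (by positivity)]
      push_cast
      rw [Complex.ofReal_cpow (by positivity)]
      simp [div_eq_mul_inv]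
  have hz : dedekindZeta F s = ((∑' n, (c n : ℝ) * (n : ℝ) ^ (-s) : ℝ) : ℂ) := by
    rw [Complex.ofReal_tsum]
    exact tsum_congr hterm
  have hsum' : Summable (fun n => (c n : ℝ) * (n : ℝ) ^ (-s)) := by
    rw [← Complex.summable_ofReal]
    exact hsum.congr (fun n => (hterm n))
  rw [hz, Complex.norm_real, Real.norm_of_nonneg (tsum_nonneg fun n => by positivity),
    ENNReal.ofReal_tsum_of_nonneg (fun n => by positivity) hsum']
  rw [← (Equiv.sigmaFiberEquiv (fun I : Ideal (𝓞 F) => Ideal.absNorm I)).tsum_eq, ENNReal.tsum_sigma']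
  refine tsum_congr fun n => ?_
  have : Finite {I : Ideal (𝓞 F) // Ideal.absNorm I = n} := Ideal.finite_setOfPred_absNorm_eq n
  have h1 : ∀ b : {I : Ideal (𝓞 F) // Ideal.absNorm I = n},
    wt s ((Equiv.sigmaFiberEquiv (fun I : Ideal (𝓞 F) => Ideal.absNorm I)) ⟨n, b⟩) = ENNReal.ofReal ((n:ℝ)^(-s)) := by
    rintro ⟨I, rfl⟩
    rfl
  rw [tsum_congr h1, ENNReal.tsum_const, ENNReal.ofReal_mul (by positivity), ENNReal.ofReal_natCast]
  congr 1
  simp [hc, ENat.card_eq_coe_natCard]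

lemma wt_bounds (F : Type*) [Field F] [NumberField F] : ∃ c C : ℝ, 0 < c ∧ 0 < C ∧
    ∀ᶠ s : ℝ in 𝓝[>] 1, ENNReal.ofReal (c / (s - 1)) ≤ (∑' I : Ideal (𝓞 F), wt s I) ∧
      (∑' I : Ideal (𝓞 F), wt s I) ≤ ENNReal.ofReal (C / (s - 1)) := by
  have hr := dedekindZeta_residue_pos F
  have h := (tendsto_sub_one_mul_dedekindZeta_nhdsGT F).norm
  rw [Complex.norm_real, Real.norm_of_nonneg hr.le] at h
  refine ⟨dedekindZeta_residue F / 2, dedekindZeta_residue F * 2, by positivity, by positivity, ?_⟩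
  filter_upwards [h.eventually (Ioo_mem_nhds (show dedekindZeta_residue F / 2 < _ by linarith)
    (show _ < dedekindZeta_residue F * 2 by linarith)), self_mem_nhdsWithin] with s hs hs1
  have hs1 : 1 < s := hs1
  have hpos : 0 < s - 1 := by linarith
  have hn : ‖((s:ℂ) - 1) * dedekindZeta F s‖ = (s - 1) * ‖dedekindZeta F s‖ := by
    rw [norm_mul]
    congr 1
    rw [← Complex.ofReal_one, ← Complex.ofReal_sub, Complex.norm_real, Real.norm_of_nonneg hpos.le]
  rw [hn] at hs
  obtain ⟨ha, hb⟩ := hs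
  have h0 : dedekindZeta F s ≠ 0 := by
    intro h0
    rw [h0] at ha
    simp at ha
    linarith
  rw [tsum_wt F s hs1 h0]
  constructor
  · apply ENNReal.ofReal_le_ofReal
    rw [div_le_iff₀ hpos]; linarith
  · apply ENNReal.ofReal_le_ofReal
    rw [le_div_iff₀ hpos]; linarith

def freeSet {R : Type*} [CommRing R] (S : Finset (Ideal R)) : Set (Ideal R) :=
  {I | I ≠ ⊥ ∧ ∀ p ∈ S, ¬ p ∣ I}

lemma freeSet_sum (F : Type*) [Field F] [NumberField F] (s : ℝ) (hs : 1 < s)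
    (hfin : (∑' I : Ideal (𝓞 F), wt s I) ≠ ⊤) (S : Finset (Ideal (𝓞 F)))
    (hS : ∀ p ∈ S, p.IsPrime ∧ p ≠ ⊥) :
    (∑' I : Ideal (𝓞 F), wt s I) ≤ 2 ^ S.card * ∑' I : freeSet S, wt s I.1 := by
  classical
  induction S using Finset.induction_on with
  | empty =>
    simp only [Finset.card_empty, pow_zero, one_mul]
    have : (∑' I : freeSet (∅ : Finset (Ideal (𝓞 F))), wt s I.1) = ∑' I : Ideal (𝓞 F), wt s I := by
      apply tsum_subtype_eq_of_support_subset
      intro I hI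
      refine ⟨?_, by simp⟩
      rintro rfl
      apply hI
      simp [wt, Real.zero_rpow (show -s ≠ 0 by linarith)]
    rw [this]
  | insert p S hp ih =>
    have ih := ih (fun q hq => hS q (Finset.mem_insert_of_mem hq))
    obtain ⟨hpp, hp0⟩ := hS p (Finset.mem_insert_self _ _)
    have hsub : freeSet S ⊆ freeSet (insert p S) ∪ (fun J => p * J) '' freeSet S := by
      intro I hI
      by_cases hd : p ∣ I
      · right
        obtain ⟨J, rfl⟩ := hd
        refine ⟨J, ⟨?_, ?_⟩, rfl⟩
        · rintro rfl
          exact hI.1 (by simp)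
        · intro q hq hqJ
          exact hI.2 q hq (hqJ.mul_left p)
      · left
        refine ⟨hI.1, ?_⟩
        intro q hq
        rcases Finset.mem_insert.mp hq with rfl | hq
        · exact hd
        · exact hI.2 q hq
    have hinj : Function.Injective (fun J : Ideal (𝓞 F) => p * J) := by
      intro a b hab
      exact mul_left_cancel₀ (by simpa using hp0) hab
    have h1 : (∑' I : freeSet S, wt s I.1) ≤ (∑' I : freeSet (insert p S), wt s I.1)
        + wt s p * ∑' I : freeSet S, wt s I.1 := by
      calc _ ≤ ∑' I : (freeSet (insert p S) ∪ (fun J => p * J) '' freeSet S : Set _), wt s I.1 :=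
            ENNReal.tsum_mono_subtype _ hsub
        _ ≤ _ := ENNReal.tsum_union_le _ _ _
        _ = _ := by
          congr 1
          rw [tsum_image (wt s) hinj.injOn, ← ENNReal.tsum_mul_left]
          exact tsum_congr fun J => wt_mul s _ _
    have hw : wt s p ≤ 1/2 := by
      unfold wt
      rw [show (1/2 : ENNReal) = ENNReal.ofReal (1/2) by
        rw [ENNReal.ofReal_div_of_pos (by norm_num)]; simp]
      apply ENNReal.ofReal_le_ofReal
      have h2 : (2:ℝ) ≤ Ideal.absNorm p := by
        have h1 : Ideal.absNorm p ≠ 1 := by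
          rw [Ne, Ideal.absNorm_eq_one_iff]; exact hpp.ne_top
        have h0 : Ideal.absNorm p ≠ 0 := by
          rw [Ne, Ideal.absNorm_eq_zero_iff]; exact hp0
        exact_mod_cast (show 2 ≤ Ideal.absNorm p by omega)
      calc (Ideal.absNorm p : ℝ) ^ (-s) ≤ (Ideal.absNorm p : ℝ) ^ (-1 : ℝ) :=
            Real.rpow_le_rpow_of_exponent_le (by linarith) (by linarith)
        _ = (Ideal.absNorm p : ℝ)⁻¹ := Real.rpow_neg_one _
        _ ≤ 1/2 := by rw [one_div]; exact inv_anti₀ (by norm_num) h2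
    have hf : (∑' I : freeSet S, wt s I.1) ≠ ⊤ :=
      ne_top_of_le_ne_top hfin (ENNReal.tsum_comp_le_tsum_of_injective Subtype.val_injective _)
    have hf2 : (∑' I : freeSet (insert p S), wt s I.1) ≠ ⊤ :=
      ne_top_of_le_ne_top hfin (ENNReal.tsum_comp_le_tsum_of_injective Subtype.val_injective _)
    have h3 : (∑' I : freeSet S, wt s I.1) ≤ 2 * ∑' I : freeSet (insert p S), wt s I.1 := by
      have h4 := h1.trans (add_le_add le_rfl (mul_le_mul_left hw _))
      lift (∑' I : freeSet S, wt s I.1) to NNReal using hf with x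
      lift (∑' I : freeSet (insert p S), wt s I.1) to NNReal using hf2 with y
      rw [show (1/2 : ENNReal) = ((1/2 : NNReal) : ENNReal) by
        rw [ENNReal.coe_div (by norm_num)]; simp] at h4
      norm_cast at h4 ⊢
      rw [← NNReal.coe_le_coe] at h4 ⊢
      push_cast at h4 ⊢
      linarith
    rw [Finset.card_insert_of_notMem hp, pow_succ, mul_assoc]
    exact ih.trans (mul_le_mul_right h3 _)

open UniqueFactorizationMonoid in
lemma no_double (K F : Type*) [Field K] [NumberField K] [Field F] [NumberField F]
    (S : Finset (Ideal (𝓞 K))) (hS : ∀ p ∈ S, p.IsPrime ∧ p ≠ ⊥)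
    (P Q : Ideal (𝓞 K) → Ideal (𝓞 F)) (c : Ideal (𝓞 F) → Ideal (𝓞 K))
    (hP : ∀ p, p.IsPrime → p ≠ ⊥ → p ∉ S → (P p).IsPrime ∧ P p ≠ ⊥ ∧ c (P p) = p ∧
      Ideal.absNorm (P p) = Ideal.absNorm p)
    (hQ : ∀ p, p.IsPrime → p ≠ ⊥ → p ∉ S → (Q p).IsPrime ∧ Q p ≠ ⊥ ∧ c (Q p) = p ∧
      Ideal.absNorm (Q p) = Ideal.absNorm p)
    (hPQ : ∀ p, p.IsPrime → p ≠ ⊥ → p ∉ S → P p ≠ Q p) : False := by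
  classical
  have hnf : ∀ a : freeSet S, ∀ p ∈ normalizedFactors a.1, p.IsPrime ∧ p ≠ ⊥ ∧ p ∉ S := by
    intro a p hp
    have hpr := prime_of_normalized_factor p hp
    refine ⟨Ideal.isPrime_of_prime hpr, hpr.ne_zero, fun h => a.2.2 p h (dvd_of_mem_normalizedFactors hp)⟩
  have key : ∀ (G : Ideal (𝓞 K) → Ideal (𝓞 F)), (∀ p, p.IsPrime → p ≠ ⊥ → p ∉ S → (G p).IsPrime ∧ G p ≠ ⊥ ∧ c (G p) = p ∧
      Ideal.absNorm (G p) = Ideal.absNorm p) → ∀ a : freeSet S,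
      normalizedFactors ((normalizedFactors a.1).map G).prod = (normalizedFactors a.1).map G ∧
      ((normalizedFactors a.1).map G).prod ≠ 0 ∧
      ∀ s, wt s ((normalizedFactors a.1).map G).prod = wt s a.1 := by
    intro G hG a
    have hpr : ∀ x ∈ (normalizedFactors a.1).map G, Prime x := by
      intro x hx
      obtain ⟨p, hp, rfl⟩ := Multiset.mem_map.mp hx
      obtain ⟨h1, h2, h3⟩ := hnf a p hp
      obtain ⟨g1, g2, -⟩ := hG p h1 h2 h3
      exact Ideal.prime_of_isPrime g2 g1
    refine ⟨?_, ?_, ?_⟩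
    · exact normalizedFactors_prod_of_prime hpr
    · exact Multiset.prod_ne_zero fun h => (hpr _ h).ne_zero rfl
    · intro s
      unfold wt
      congr 3
      conv_rhs => rw [← Ideal.prod_normalizedFactors_eq_self a.2.1]
      rw [map_multiset_prod, map_multiset_prod, Multiset.map_map]
      congr 1
      apply Multiset.map_congr rfl
      intro p hp
      obtain ⟨h1, h2, h3⟩ := hnf a p hp
      exact (hG p h1 h2 h3).2.2.2
  let φ : freeSet S × freeSet S → Ideal (𝓞 F) := fun x =>
    ((normalizedFactors x.1.1).map P).prod * ((normalizedFactors x.2.1).map Q).prod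
  have hrec : ∀ x, normalizedFactors (φ x) = (normalizedFactors x.1.1).map P + (normalizedFactors x.2.1).map Q := by
    intro x
    obtain ⟨a1, a2, -⟩ := key P hP x.1
    obtain ⟨b1, b2, -⟩ := key Q hQ x.2
    simp only [φ]
    rw [normalizedFactors_mul a2 b2, a1, b1]
  have hr1 : ∀ x, (((normalizedFactors (φ x)).filter (fun q => P (c q) = q)).map c).prod = x.1.1 := by
    intro x
    rw [hrec, Multiset.filter_add, Multiset.filter_eq_self.mpr, Multiset.filter_eq_nil.mpr, add_zero,
      Multiset.map_map]
    · conv_rhs => rw [← Ideal.prod_normalizedFactors_eq_self x.1.2.1]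
      congr 1
      conv_rhs => rw [← Multiset.map_id (normalizedFactors x.1.1)]
      apply Multiset.map_congr rfl
      intro p hp
      obtain ⟨h1, h2, h3⟩ := hnf x.1 p hp
      exact (hP p h1 h2 h3).2.2.1
    · intro q hq
      obtain ⟨p, hp, rfl⟩ := Multiset.mem_map.mp hq
      obtain ⟨h1, h2, h3⟩ := hnf x.2 p hp
      rw [(hQ p h1 h2 h3).2.2.1]
      exact hPQ p h1 h2 h3
    · intro q hq
      obtain ⟨p, hp, rfl⟩ := Multiset.mem_map.mp hq
      obtain ⟨h1, h2, h3⟩ := hnf x.1 p hp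
      rw [(hP p h1 h2 h3).2.2.1]
  have hr2 : ∀ x, (((normalizedFactors (φ x)).filter (fun q => Q (c q) = q)).map c).prod = x.2.1 := by
    intro x
    rw [hrec, Multiset.filter_add, Multiset.filter_eq_nil.mpr, Multiset.filter_eq_self.mpr, zero_add,
      Multiset.map_map]
    · conv_rhs => rw [← Ideal.prod_normalizedFactors_eq_self x.2.2.1]
      congr 1
      conv_rhs => rw [← Multiset.map_id (normalizedFactors x.2.1)]
      apply Multiset.map_congr rfl
      intro p hp
      obtain ⟨h1, h2, h3⟩ := hnf x.2 p hp
      exact (hQ p h1 h2 h3).2.2.1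
    · intro q hq
      obtain ⟨p, hp, rfl⟩ := Multiset.mem_map.mp hq
      obtain ⟨h1, h2, h3⟩ := hnf x.2 p hp
      rw [(hQ p h1 h2 h3).2.2.1]
    · intro q hq
      obtain ⟨p, hp, rfl⟩ := Multiset.mem_map.mp hq
      obtain ⟨h1, h2, h3⟩ := hnf x.1 p hp
      rw [(hP p h1 h2 h3).2.2.1]
      exact (hPQ p h1 h2 h3).symm
  have hinj : Function.Injective φ := by
    intro x y hxy
    ext1 <;> apply Subtype.ext
    · rw [← hr1 x, ← hr1 y, hxy]
    · rw [← hr2 x, ← hr2 y, hxy]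
  have hsq : ∀ s, (∑' I : freeSet S, wt s I.1) * (∑' I : freeSet S, wt s I.1) ≤ ∑' I : Ideal (𝓞 F), wt s I := by
    intro s
    calc _ = ∑' x : freeSet S × freeSet S, wt s (φ x) := by
          rw [ENNReal.tsum_prod', ← ENNReal.tsum_mul_right]
          refine tsum_congr fun a => ?_
          rw [← ENNReal.tsum_mul_left]
          refine tsum_congr fun b => ?_
          simp only [φ]
          rw [wt_mul, (key P hP a).2.2 s, (key Q hQ b).2.2 s]
      _ ≤ _ := ENNReal.tsum_comp_le_tsum_of_injective hinj _
  obtain ⟨c1, C1, hc1, hC1, hK⟩ := wt_bounds K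
  obtain ⟨c2, C2, hc2, hC2, hF⟩ := wt_bounds F
  have hev : ∀ᶠ s : ℝ in 𝓝[>] 1, c1 ^ 2 ≤ 4 ^ S.card * C2 * (s - 1) := by
    filter_upwards [hK, hF, self_mem_nhdsWithin] with s hsK hsF hs1
    have hs1 : 1 < s := hs1
    have hpos : 0 < s - 1 := by linarith
    have h1 := hsK.1.trans (freeSet_sum K s hs1 (ne_top_of_le_ne_top ENNReal.ofReal_ne_top hsK.2) S hS)
    have h2 := (hsq s).trans hsF.2
    have h3 := mul_le_mul' h1 h1
    have h4 : ENNReal.ofReal (c1 / (s-1)) * ENNReal.ofReal (c1 / (s-1)) ≤ 4 ^ S.card * ENNReal.ofReal (C2 / (s-1)) := by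
      refine h3.trans ?_
      rw [mul_mul_mul_comm, ← mul_pow]
      norm_num
      exact mul_le_mul_right h2 _
    rw [← ENNReal.ofReal_mul (by positivity), show (4 : ENNReal) = ENNReal.ofReal 4 by simp,
      ← ENNReal.ofReal_pow (by norm_num), ← ENNReal.ofReal_mul (by positivity),
      ENNReal.ofReal_le_ofReal_iff (by positivity)] at h4
    have h5 := mul_le_mul_of_nonneg_right h4 (show 0 ≤ (s-1)^2 by positivity)
    have e1 : c1 / (s-1) * (c1/(s-1)) * (s-1)^2 = c1^2 := by field_simp
    have e2 : 4 ^ S.card * (C2 / (s-1)) * (s-1)^2 = 4 ^ S.card * C2 * (s-1) := by field_simp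
    rwa [e1, e2] at h5
  have hlim : Tendsto (fun s : ℝ => 4 ^ S.card * C2 * (s - 1)) (𝓝[>] 1) (𝓝 0) := by
    have : Tendsto (fun s : ℝ => 4 ^ S.card * C2 * (s - 1)) (𝓝 1) (𝓝 (4 ^ S.card * C2 * (1 - 1))) :=
      (Continuous.tendsto (by fun_prop) 1)
    simp only [sub_self, mul_zero] at this
    exact this.mono_left nhdsWithin_le_nhds
  have := ge_of_tendsto hlim hev
  have : 0 < c1 ^ 2 := by positivity
  linarith

end WDFA
namespace WDFA

lemma bad_finite (K L : Type*) [Field K] [NumberField K] [Field L] [NumberField L] [Algebra K L]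
    (d : 𝓞 L) (hd : d ≠ 0) :
    {p : Ideal (𝓞 K) | ∃ P : Ideal (𝓞 L), P.IsPrime ∧ P ≠ ⊥ ∧ d ∈ P ∧ P.under (𝓞 K) = p}.Finite := by
  have h := Ideal.finite_factors (R := 𝓞 L) (I := Ideal.span {d}) (by simpa using hd)
  refine (h.image (fun v => v.asIdeal.under (𝓞 K))).subset ?_
  rintro p ⟨P, hP, hP0, hdP, rfl⟩
  refine ⟨⟨P, hP, hP0⟩, ?_, rfl⟩
  simpa [Ideal.dvd_span_singleton] using hdP

lemma residue_one (K F : Type*) [Field K] [NumberField K] [Field F] [NumberField F] [Algebra K F]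
    (P : Ideal (𝓞 F)) (hP : P.IsPrime) (hP0 : P ≠ ⊥)
    (h : ∀ x : 𝓞 F, x ^ (Ideal.absNorm (P.under (𝓞 K))) - x ∈ P) :
    Ideal.absNorm P = Ideal.absNorm (P.under (𝓞 K)) ∧
      ∀ x : 𝓞 F, ∃ a : 𝓞 K, x - algebraMap (𝓞 K) (𝓞 F) a ∈ P := by
  classical
  have hmax : P.IsMaximal := hP.isMaximal hP0
  have hp0 : P.under (𝓞 K) ≠ ⊥ := Ideal.under_ne_bot (𝓞 K) hP0
  have hpP : (P.under (𝓞 K)).IsPrime := inferInstance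
  have hf : Finite (𝓞 F ⧸ P) := Ideal.finiteQuotientOfFreeOfNeBot P hP0
  have hf' : Finite (𝓞 K ⧸ P.under (𝓞 K)) := Ideal.finiteQuotientOfFreeOfNeBot _ hp0
  let i : 𝓞 K ⧸ P.under (𝓞 K) →+* 𝓞 F ⧸ P := algebraMap _ _
  have hi : Function.Injective i := Ideal.algebraMap_quotient_injective
  have hq : Ideal.absNorm (P.under (𝓞 K)) = Nat.card (𝓞 K ⧸ P.under (𝓞 K)) := by
    rw [Ideal.absNorm_apply, Submodule.cardQuot_apply]
  have hqP : Ideal.absNorm P = Nat.card (𝓞 F ⧸ P) := by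
    rw [Ideal.absNorm_apply, Submodule.cardQuot_apply]
  have hq1 : 1 < Ideal.absNorm (P.under (𝓞 K)) := by
    rw [hq]
    have := Ideal.Quotient.nontrivial_iff.mpr hpP.ne_top
    exact Finite.one_lt_card
  set q := Ideal.absNorm (P.under (𝓞 K)) with hqdef
  let _ : Field (𝓞 F ⧸ P) := Ideal.Quotient.field P
  have hroot : ∀ y : 𝓞 F ⧸ P, y ^ q - y = 0 := by
    intro y
    obtain ⟨x, rfl⟩ := Ideal.Quotient.mk_surjective y
    have := Ideal.Quotient.eq_zero_iff_mem.mpr (h x)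
    simpa using this
  have hle : Nat.card (𝓞 F ⧸ P) ≤ q := by
    have := Fintype.ofFinite (𝓞 F ⧸ P)
    rw [Nat.card_eq_fintype_card]
    have hne : (Polynomial.X ^ q - Polynomial.X : Polynomial (𝓞 F ⧸ P)) ≠ 0 :=
      FiniteField.X_pow_card_sub_X_ne_zero _ hq1
    have hdeg := FiniteField.X_pow_card_sub_X_natDegree_eq (𝓞 F ⧸ P) hq1
    rw [← hdeg, ← Finset.card_univ]
    refine (Finset.card_le_card (t := (Polynomial.X ^ q - Polynomial.X : Polynomial (𝓞 F ⧸ P)).roots.toFinset) ?_).trans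
      ((Multiset.toFinset_card_le _).trans (Polynomial.card_roots' _))
    intro y _
    rw [Multiset.mem_toFinset, Polynomial.mem_roots hne, Polynomial.IsRoot]
    simpa using hroot y
  have hge : q ≤ Nat.card (𝓞 F ⧸ P) := by
    rw [hq]; exact Nat.card_le_card_of_injective i hi
  refine ⟨by rw [hqP]; omega, ?_⟩
  have hbij : Function.Bijective i := by
    rw [Nat.bijective_iff_injective_and_card]
    exact ⟨hi, by omega⟩
  intro x
  obtain ⟨y, hy⟩ := hbij.2 (Ideal.Quotient.mk P x)
  obtain ⟨a, rfl⟩ := Ideal.Quotient.mk_surjective y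
  refine ⟨a, ?_⟩
  rw [← Ideal.Quotient.eq_zero_iff_mem, map_sub, ← hy, sub_eq_zero]
  rfl

lemma frob_generate (K L : Type*) [Field K] [NumberField K] [Field L] [NumberField L] [Algebra K L]
    [IsGalois K L] (H : Subgroup Gal(L/K)) (S : Set (Ideal (𝓞 K))) (hS : S.Finite)
    (hH : ∀ P : Ideal (𝓞 L), P.IsPrime → P ≠ ⊥ → P.under (𝓞 K) ∉ S →
      ∃ σ ∈ H, ∀ x : 𝓞 L, σ • x - x ^ (Ideal.absNorm (P.under (𝓞 K))) ∈ P) : H = ⊤ := by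
  classical
  by_contra hne
  obtain ⟨σ₀, hσ₀⟩ : ∃ σ, σ ∉ H := by
    by_contra! hall
    exact hne (eq_top_iff.mpr fun σ _ => hall σ)
  let F := IntermediateField.fixedField H
  have hfix : ∃ θ : F, σ₀ (θ : L) ≠ θ := by
    by_contra! hall
    apply hσ₀
    rw [← IntermediateField.fixingSubgroup_fixedField H, IntermediateField.mem_fixingSubgroup_iff]
    intro x hx
    exact hall ⟨x, hx⟩
  obtain ⟨θ, hθ⟩ : ∃ θ : 𝓞 F, σ₀ • algebraMap (𝓞 F) (𝓞 L) θ ≠ algebraMap (𝓞 F) (𝓞 L) θ := by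
    by_contra! hall
    obtain ⟨θ, hθ⟩ := hfix
    apply hθ
    have key : ∀ x : 𝓞 F, σ₀ (algebraMap F L (algebraMap (𝓞 F) F x)) = algebraMap F L (algebraMap (𝓞 F) F x) := by
      intro x
      have := congrArg (algebraMap (𝓞 L) L) (hall x)
      exact this
    obtain ⟨x, y, hy, hxy⟩ := IsFractionRing.div_surjective (A := 𝓞 F) θ
    have : (θ : L) = algebraMap F L θ := rfl
    rw [this, ← hxy, map_div₀, map_div₀, key, key]
  have hHF : ∀ σ ∈ H, ∀ x : 𝓞 F, σ • algebraMap (𝓞 F) (𝓞 L) x = algebraMap (𝓞 F) (𝓞 L) x := by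
    intro σ hσ x
    apply RingOfIntegers.coe_injective
    exact (x : F).2 ⟨σ, hσ⟩
  let s0 : 𝓞 L →+* 𝓞 L := MulSemiringAction.toRingHom Gal(L/K) (𝓞 L) σ₀
  let d := s0 (algebraMap (𝓞 F) (𝓞 L) θ) - algebraMap (𝓞 F) (𝓞 L) θ
  have hd : d ≠ 0 := sub_ne_zero.mpr hθ
  have hT := hS.union (bad_finite K L d hd)
  let T : Finset (Ideal (𝓞 K)) := hT.toFinset.filter (fun p => p.IsPrime ∧ p ≠ ⊥)
  have hex : ∀ p : Ideal (𝓞 K), p.IsPrime → ∃ P : Ideal (𝓞 L), P.IsPrime ∧ P.under (𝓞 K) = p := by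
    intro p hp
    obtain ⟨P, -, h1, h2⟩ := Ideal.exists_ideal_over_prime_of_isIntegral (S := 𝓞 L) p ⊥ (by
      rw [← RingHom.ker_eq_comap_bot, (RingHom.injective_iff_ker_eq_bot _).mp (FaithfulSMul.algebraMap_injective (𝓞 K) (𝓞 L))]; exact bot_le)
    exact ⟨P, h1, h2⟩
  choose! A hA1 hA2 using hex
  have hA0 : ∀ p : Ideal (𝓞 K), p.IsPrime → p ≠ ⊥ → A p ≠ ⊥ := by
    intro p hp hp0 h
    apply hp0
    rw [← hA2 p hp, h]
    exact Ideal.under_bot _ _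
  have hs0K : ∀ a : 𝓞 K, s0 (algebraMap (𝓞 K) (𝓞 L) a) = algebraMap (𝓞 K) (𝓞 L) a := fun a =>
    smul_algebraMap σ₀ a
  -- general fact
  have gen : ∀ p : Ideal (𝓞 K), p.IsPrime → p ≠ ⊥ → p ∉ S → ∀ B : Ideal (𝓞 L), B.IsPrime → B.under (𝓞 K) = p →
      (B.under (𝓞 F)).IsPrime ∧ B.under (𝓞 F) ≠ ⊥ ∧ (B.under (𝓞 F)).under (𝓞 K) = p ∧
      Ideal.absNorm (B.under (𝓞 F)) = Ideal.absNorm p ∧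
      ∀ x : 𝓞 F, ∃ a : 𝓞 K, x - algebraMap (𝓞 K) (𝓞 F) a ∈ B.under (𝓞 F) := by
    intro p hp hp0 hpS B hB hBp
    have hB0 : B ≠ ⊥ := by
      rintro rfl
      exact hp0 (by rw [← hBp]; exact Ideal.under_bot _ _)
    have h3 : (B.under (𝓞 F)).under (𝓞 K) = p := by rw [Ideal.under_under, hBp]
    have h1 : (B.under (𝓞 F)).IsPrime := inferInstance
    have h2 : B.under (𝓞 F) ≠ ⊥ := Ideal.under_ne_bot (𝓞 F) hB0
    obtain ⟨σ, hσ, hσB⟩ := hH B hB hB0 (by rwa [hBp])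
    obtain ⟨h4, h5⟩ := residue_one K F (B.under (𝓞 F)) h1 h2 (by
      intro x
      rw [h3, Ideal.under_def, Ideal.mem_comap]
      have := hσB (algebraMap (𝓞 F) (𝓞 L) x)
      rw [hHF σ hσ, hBp] at this
      have := neg_mem this
      simpa using this)
    rw [h3] at h4
    exact ⟨h1, h2, h3, h4, h5⟩
  have hA' : ∀ p : Ideal (𝓞 K), p.IsPrime → ((A p).comap s0).IsPrime ∧ ((A p).comap s0).under (𝓞 K) = p := by
    intro p hp
    have := hA1 p hp
    refine ⟨Ideal.comap_isPrime s0 _, ?_⟩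
    ext a
    conv_rhs => rw [← hA2 p hp]
    simp only [Ideal.under_def, Ideal.mem_comap, hs0K]
  have hnT : ∀ p : Ideal (𝓞 K), p.IsPrime → p ≠ ⊥ → p ∉ T → p ∉ S := by
    intro p hp hp0 hpT hpS
    apply hpT
    simp only [T, Finset.mem_filter, Set.Finite.mem_toFinset]
    exact ⟨Or.inl hpS, hp, hp0⟩
  refine no_double K F T (fun p hp => (Finset.mem_filter.mp hp).2)
    (fun p => (A p).under (𝓞 F)) (fun p => ((A p).comap s0).under (𝓞 F)) (fun Q => Q.under (𝓞 K)) ?_ ?_ ?_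
  · intro p hp hp0 hpT
    obtain ⟨h1, h2, h3, h4, -⟩ := gen p hp hp0 (hnT p hp hp0 hpT) (A p) (hA1 p hp) (hA2 p hp)
    exact ⟨h1, h2, h3, h4⟩
  · intro p hp hp0 hpT
    obtain ⟨h1, h2, h3, h4, -⟩ := gen p hp hp0 (hnT p hp hp0 hpT) _ (hA' p hp).1 (hA' p hp).2
    exact ⟨h1, h2, h3, h4⟩
  · intro p hp hp0 hpT heq
    obtain ⟨h1, h2, h3, h4, h5⟩ := gen p hp hp0 (hnT p hp hp0 hpT) (A p) (hA1 p hp) (hA2 p hp)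
    obtain ⟨a, ha⟩ := h5 θ
    have ha' := ha
    rw [heq] at ha'
    rw [Ideal.under_def, Ideal.mem_comap, map_sub, ← IsScalarTower.algebraMap_apply] at ha ha'
    rw [Ideal.mem_comap, map_sub, hs0K] at ha'
    apply hpT
    simp only [T, Finset.mem_filter, Set.Finite.mem_toFinset]
    refine ⟨Or.inr ⟨A p, hA1 p hp, hA0 p hp hp0, ?_, hA2 p hp⟩, hp, hp0⟩
    have := sub_mem ha' ha
    simpa [d] using this

end WDFA
namespace WDFA

lemma galois_real (K : Type*) [Field K] [NumberField K] (Ξ : Set (NZI (𝓞 K) → Kbar K))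
    (hU0 : ∀ ξ ∈ Ξ, ξ ∈ USet K 0) (hU1 : ∀ ξ ∈ Ξ, ξ ∈ USet K 1)
    (hT : {t | ∃ ξ ∈ Ξ, ∃ c, ξ c = t}.Finite) (σ : Gal(Kbar K/K)) :
    ∃ b : NZI (𝓞 K), ∀ ξ ∈ Ξ, ∀ c, σ (ξ c) = ξ (b * c) := by
  classical
  set T := {t | ∃ ξ ∈ Ξ, ∃ c, ξ c = t} with hTdef
  let E := IntermediateField.adjoin K T
  have hE : FiniteDimensional K E := by
    have := hT.to_subtype
    exact IntermediateField.finiteDimensional_adjoin fun x _ => Algebra.IsIntegral.isIntegral x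
  let L : IntermediateField K (Kbar K) := IntermediateField.normalClosure K E (Kbar K)
  have hEL : E ≤ L := IntermediateField.le_normalClosure E
  have hnorm : Normal K L := inferInstance
  have hfd : FiniteDimensional K L := inferInstance
  have hgal : IsGalois K L := ⟨⟩
  have hnf : NumberField L := NumberField.of_module_finite K L
  have hV : ∀ ξ ∈ Ξ, ∀ c, ∃ v : 𝓞 L, ((v : L) : Kbar K) = ξ c := by
    intro ξ hξ c
    have hm : ξ c ∈ L := hEL (IntermediateField.subset_adjoin K T ⟨ξ, hξ, c, rfl⟩)
    have hi : IsIntegral (𝓞 K) (ξ c) := hU0 ξ hξ c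
    have hi' : IsIntegral ℤ (ξ c) := isIntegral_trans _ hi
    have hi'' : IsIntegral ℤ (⟨ξ c, hm⟩ : L) := by
      rw [← isIntegral_algebraMap_iff (B := Kbar K) (algebraMap L (Kbar K)).injective]
      exact hi'
    exact ⟨⟨⟨ξ c, hm⟩, hi''⟩, rfl⟩
  choose! V hV using hV
  have hcinj : Function.Injective (fun v : 𝓞 L => ((v : L) : Kbar K)) :=
    Subtype.val_injective.comp RingOfIntegers.coe_injective
  have hT' : {t | ∃ ξ ∈ Ξ, ∃ c, V ξ c = t}.Finite := by
    refine Set.Finite.of_finite_image (f := fun v : 𝓞 L => ((v : L) : Kbar K)) (hT.subset ?_) hcinj.injOn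
    rintro _ ⟨_, ⟨ξ, hξ, c, rfl⟩, rfl⟩
    exact ⟨ξ, hξ, c, (hV ξ hξ c).symm⟩
  set T' := {t | ∃ ξ ∈ Ξ, ∃ c, V ξ c = t} with hT'def
  -- congruence
  have hcong : ∀ P : Ideal (𝓞 L), P.IsPrime → ∀ hp : P.under (𝓞 K) ≠ ⊥, ∀ ξ ∈ Ξ, ∀ c,
      V ξ (⟨P.under (𝓞 K), hp⟩ * c) - V ξ c ^ (Ideal.absNorm (P.under (𝓞 K))) ∈ P := by
    intro P hP hp ξ hξ c
    let Z := integralClosure (𝓞 L) (Kbar K)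
    obtain ⟨Q, -, hQ, hQP⟩ := Ideal.exists_ideal_over_prime_of_isIntegral (S := Z) P ⊥ (by
      rw [← RingHom.ker_eq_comap_bot, (RingHom.injective_iff_ker_eq_bot _).mp (FaithfulSMul.algebraMap_injective (𝓞 L) Z)]; exact bot_le)
    have hpp : (P.under (𝓞 K)).IsPrime := inferInstance
    have h1 := (hU1 ξ hξ).2 (P.under (𝓞 K)) hpp hp
    have h2 : ∀ x ∈ Submodule.span (𝓞 K) {x | ∃ r ∈ P.under (𝓞 K), ∃ η ∈ USet K 0, x = r • η}, ∀ c,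
        ∃ z ∈ Q, (z : Kbar K) = x c := by
      intro x hx
      induction hx using Submodule.span_induction with
      | mem x hx =>
        intro c
        obtain ⟨r, hr, η, hη, rfl⟩ := hx
        have hηi : IsIntegral (𝓞 L) (η c) := by
          have : IsIntegral (𝓞 K) (η c) := hη c
          have : IsIntegral ℤ (η c) := isIntegral_trans _ this
          exact this.tower_top
        have hr' : algebraMap (𝓞 L) Z (algebraMap (𝓞 K) (𝓞 L) r) ∈ Q := by
          rw [← hQP] at hr
          exact hr
        refine ⟨_, Q.mul_mem_right (⟨η c, hηi⟩ : Z) hr', ?_⟩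
        exact Eq.trans rfl (Algebra.smul_def r (η c)).symm
      | zero => exact fun c => ⟨0, Q.zero_mem, rfl⟩
      | add x y _ _ hx hy =>
        intro c
        obtain ⟨z, hz, hz'⟩ := hx c
        obtain ⟨w, hw, hw'⟩ := hy c
        exact ⟨z + w, Q.add_mem hz hw, by rw [Pi.add_apply, ← hz', ← hw']; rfl⟩
      | smul r x _ hx =>
        intro c
        obtain ⟨z, hz, hz'⟩ := hx c
        refine ⟨_, Q.mul_mem_left (algebraMap (𝓞 L) Z (algebraMap (𝓞 K) (𝓞 L) r)) hz, ?_⟩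
        refine Eq.trans ?_ (Algebra.smul_def r (x c)).symm
        rw [← hz']
        rfl
    obtain ⟨z, hz, hz'⟩ := h2 _ h1 c
    have hPQ : ∀ y, algebraMap (𝓞 L) Z y ∈ Q → y ∈ P := fun y hy => by
      rw [← hQP, Ideal.mem_comap]; exact hy
    apply hPQ
    convert hz
    apply Subtype.ext
    rw [hz']
    simp only [Pi.sub_apply, Pi.pow_apply, shiftI]
    rw [← hV ξ hξ, ← hV ξ hξ]
    simp only [map_sub, map_pow]
    rfl
  let M : Submonoid Gal(L/K) :=
    { carrier := {g | ∃ b : NZI (𝓞 K), ∀ ξ ∈ Ξ, ∀ c, g • V ξ c = V ξ (b * c)}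
      one_mem' := ⟨1, fun ξ _ c => by rw [one_smul, one_mul]⟩
      mul_mem' := by
        rintro g h ⟨b, hb⟩ ⟨b', hb'⟩
        refine ⟨b * b', fun ξ hξ c => ?_⟩
        rw [mul_smul, hb' ξ hξ, hb ξ hξ, mul_assoc] }
  let H : Subgroup Gal(L/K) :=
    { M with
      inv_mem' := by
        intro g hg
        have h1 : g⁻¹ ∈ Submonoid.powers g := by
          rw [(isOfFinOrder_of_finite g).mem_powers_iff_mem_zpowers]
          exact inv_mem (Subgroup.mem_zpowers g)
        exact (Submonoid.powers_le (P := M)).mpr hg h1 }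
  let D : Set (𝓞 L) := {d | d ≠ 0 ∧ ∃ g : Gal(L/K), ∃ u ∈ T', ∃ t ∈ T', d = g • u - t}
  have hD : D.Finite := by
    have : ((Set.univ : Set Gal(L/K)) ×ˢ (T' ×ˢ T')).Finite := Set.finite_univ.prod (hT'.prod hT')
    refine (this.image (fun x => x.1 • x.2.1 - x.2.2)).subset ?_
    rintro d ⟨-, g, u, hu, t, ht, rfl⟩
    exact ⟨⟨g, u, t⟩, ⟨trivial, hu, ht⟩, rfl⟩
  have hS : (⋃ d ∈ D, {p : Ideal (𝓞 K) | ∃ P : Ideal (𝓞 L), P.IsPrime ∧ P ≠ ⊥ ∧ d ∈ P ∧ P.under (𝓞 K) = p}).Finite :=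
    hD.biUnion fun d hd => bad_finite K L d hd.1
  have hHtop : H = ⊤ := by
    refine frob_generate K L H _ hS ?_
    intro P hP hP0 hPS
    have hf : Finite (𝓞 L ⧸ P) := Ideal.finiteQuotientOfFreeOfNeBot P hP0
    obtain ⟨g, hg⟩ := IsArithFrobAt.exists_of_isInvariant (𝓞 K) Gal(L/K) P
    have hg' : ∀ x : 𝓞 L, g • x - x ^ (Ideal.absNorm (P.under (𝓞 K))) ∈ P := by
      intro x
      rw [Ideal.absNorm_apply, Submodule.cardQuot_apply]
      exact hg x
    refine ⟨g, ?_, hg'⟩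
    have hp : P.under (𝓞 K) ≠ ⊥ := Ideal.under_ne_bot (𝓞 K) hP0
    refine ⟨⟨P.under (𝓞 K), hp⟩, fun ξ hξ c => ?_⟩
    by_contra hne
    apply hPS
    refine Set.mem_biUnion (x := g • V ξ c - V ξ (⟨P.under (𝓞 K), hp⟩ * c))
      ⟨sub_ne_zero.mpr hne, g, _, ⟨ξ, hξ, c, rfl⟩, _, ⟨ξ, hξ, _, rfl⟩, rfl⟩ ⟨P, hP, hP0, ?_, rfl⟩
    have := sub_mem (hg' (V ξ c)) (hcong P hP hp ξ hξ c)
    simpa using this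
  have hmem : σ.restrictNormal L ∈ H := by rw [hHtop]; trivial
  obtain ⟨b, hb⟩ := hmem
  refine ⟨b, fun ξ hξ c => ?_⟩
  have h1 := congrArg (fun v : 𝓞 L => ((v : L) : Kbar K)) (hb ξ hξ c)
  rw [hV ξ hξ] at h1
  rw [← h1, ← hV ξ hξ c]
  exact (AlgEquiv.restrictNormal_commutes σ L (V ξ c : L)).symm

end WDFA
namespace WDFA

def mrel (K : Type*) [Field K] [NumberField K] (Ξ : Set (NZI (𝓞 K) → Kbar K)) : Setoid (NZI (𝓞 K)) where
  r a b := ∀ ξ ∈ Ξ, ∀ c, ξ (a * c) = ξ (b * c)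
  iseqv := ⟨fun _ _ _ _ => rfl, fun h ξ hξ c => (h ξ hξ c).symm,
    fun h h' ξ hξ c => (h ξ hξ c).trans (h' ξ hξ c)⟩

lemma wordProd_cons (K : Type*) [Field K] [NumberField K] (p) (w) :
    wordProd K (p :: w) = ⟨p.1, p.2.2⟩ * wordProd K w := by
  simp [wordProd]

lemma wordProd_append (K : Type*) [Field K] [NumberField K] (v w) :
    wordProd K (v ++ w) = wordProd K v * wordProd K w := by
  simp [wordProd]

lemma wordProd_surj (K : Type*) [Field K] [NumberField K] (a : NZI (𝓞 K)) :
    ∃ w, wordProd K w = a := by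
  have : ∀ I : Ideal (𝓞 K), I ≠ ⊥ → ∃ w, (wordProd K w).1 = I := by
    intro I
    induction I using UniqueFactorizationMonoid.induction_on_prime with
    | h₁ => exact fun h => absurd rfl h
    | h₂ x hx =>
      intro _
      refine ⟨[], ?_⟩
      rw [Ideal.isUnit_iff] at hx
      rw [hx]
      simp [wordProd]
    | h₃ J p hJ hp ih =>
      intro _
      obtain ⟨w, hw⟩ := ih hJ
      refine ⟨⟨p, Ideal.isPrime_of_prime hp, hp.ne_zero⟩ :: w, ?_⟩
      rw [wordProd_cons]
      show p * (wordProd K w).1 = _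
      rw [hw]
  obtain ⟨w, hw⟩ := this a.1 a.2
  exact ⟨w, Subtype.ext hw⟩

lemma dfa_inj (K : Type*) [Field K] [NumberField K] (Ξ : Set (NZI (𝓞 K) → Kbar K))
    (A : WittDFA K) (hA : Generates K A Ξ) :
    ∃ f : Quotient (mrel K Ξ) → A.S, Function.Injective f := by
  choose W hW using wordProd_surj K
  refine ⟨fun m => (W m.out).foldl A.δ A.s0, ?_⟩
  intro m m' h
  simp only at h
  rw [← m.out_eq, ← m'.out_eq]
  apply Quotient.sound
  intro ξ hξ c
  obtain ⟨τ, -, hτ⟩ := hA ξ hξ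
  rw [← hW m.out, ← hW m'.out, ← hW c, ← wordProd_append, ← wordProd_append, hτ, hτ,
    List.foldl_append, List.foldl_append, h]

lemma dfa_exists (K : Type*) [Field K] [NumberField K] (Ξ : Set (NZI (𝓞 K) → Kbar K))
    (hU0 : ∀ ξ ∈ Ξ, ξ ∈ USet K 0) [Finite (Quotient (mrel K Ξ))] :
    ∃ A : WittDFA K, Generates K A Ξ ∧ Nat.card A.S = Nat.card (Quotient (mrel K Ξ)) := by
  let e := Finite.equivFin (Quotient (mrel K Ξ))
  let step : {p : Ideal (𝓞 K) // p.IsPrime ∧ p ≠ ⊥} → Quotient (mrel K Ξ) → Quotient (mrel K Ξ) :=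
    fun p => Quotient.map (fun a => a * ⟨p.1, p.2.2⟩) (by
      intro a b hab ξ hξ c
      simp only [mul_assoc]
      exact hab ξ hξ _)
  let A : WittDFA K :=
    { S := Fin (Nat.card (Quotient (mrel K Ξ)))
      δ := fun s p => e (step p (e.symm s))
      s0 := e (Quotient.mk _ 1) }
  have hfold : ∀ w a, w.foldl A.δ (e (Quotient.mk _ a)) = e (Quotient.mk _ (a * wordProd K w)) := by
    intro w
    induction w with
    | nil => intro a; simp [wordProd]
    | cons p w ih =>
      intro a
      rw [List.foldl_cons, wordProd_cons, ← mul_assoc, ← ih]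
      congr 1
      simp only [A, Equiv.symm_apply_apply]
      rfl
  refine ⟨A, ?_, by simp [A]⟩
  intro ξ hξ
  refine ⟨fun s => ξ (e.symm s).out, fun s => hU0 ξ hξ _, fun w => ?_⟩
  have h1 : w.foldl A.δ A.s0 = _ := hfold w 1
  rw [h1, one_mul]
  simp only [Equiv.symm_apply_apply]
  have h2 : (mrel K Ξ).r (Quotient.mk (mrel K Ξ) (wordProd K w)).out (wordProd K w) :=
    Quotient.mk_out (s := mrel K Ξ) (wordProd K w)
  have := h2 ξ hξ 1
  simpa using this.symm

lemma sc_eq (K : Type*) [Field K] [NumberField K] (Ξ : Set (NZI (𝓞 K) → Kbar K))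
    (hU0 : ∀ ξ ∈ Ξ, ξ ∈ USet K 0) : stateComplexity K Ξ = Nat.card (Quotient (mrel K Ξ)) := by
  unfold stateComplexity
  rcases finite_or_infinite (Quotient (mrel K Ξ)) with hf | hi
  · apply IsLeast.csInf_eq
    refine ⟨dfa_exists K Ξ hU0, ?_⟩
    rintro n ⟨A, hA, rfl⟩
    have := A.fin
    obtain ⟨f, hf⟩ := dfa_inj K Ξ A hA
    exact Nat.card_le_card_of_injective f hf
  · rw [Nat.card_eq_zero_of_infinite]
    convert Nat.sInf_empty
    rw [Set.eq_empty_iff_forall_notMem]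
    rintro n ⟨A, hA, rfl⟩
    have := A.fin
    obtain ⟨f, hf⟩ := dfa_inj K Ξ A hA
    exact (Finite.of_injective f hf).false

lemma ev_inj (K : Type*) [Field K] [NumberField K] (Ξ : Set (NZI (𝓞 K) → Kbar K)) :
    ∃ f : Quotient (mrel K Ξ) → (XXi K Ξ →ₐ[K] Kbar K), Function.Injective f := by
  refine ⟨fun m => (Pi.evalAlgHom K (fun _ => Kbar K) m.out).comp (XXi K Ξ).val, ?_⟩
  intro m m' h
  rw [← m.out_eq, ← m'.out_eq]
  apply Quotient.sound
  intro ξ hξ c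
  have := DFunLike.congr_fun h ⟨shiftI c ξ, Algebra.subset_adjoin ⟨c, ξ, hξ, rfl⟩⟩
  have h2 : ξ (c * m.out) = ξ (c * m'.out) := this
  rwa [mul_comm c, mul_comm c] at h2

lemma X_rel (K : Type*) [Field K] [NumberField K] (Ξ : Set (NZI (𝓞 K) → Kbar K))
    (x) (hx : x ∈ XXi K Ξ) (a b) (hab : (mrel K Ξ).r a b) : x a = x b := by
  induction hx using Algebra.adjoin_induction with
  | mem x hx =>
    obtain ⟨c, ξ, hξ, rfl⟩ := hx
    have := hab ξ hξ c
    simp only [shiftI]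
    rwa [mul_comm c, mul_comm c]
  | algebraMap r => rfl
  | add x y _ _ hx hy => rw [Pi.add_apply, Pi.add_apply, hx, hy]
  | mul x y _ _ hx hy => rw [Pi.mul_apply, Pi.mul_apply, hx, hy]

lemma X_gal (K : Type*) [Field K] [NumberField K] (Ξ : Set (NZI (𝓞 K) → Kbar K))
    (σ : Gal(Kbar K/K)) (b) (hb : ∀ ξ ∈ Ξ, ∀ c, σ (ξ c) = ξ (b * c))
    (x) (hx : x ∈ XXi K Ξ) : ∀ c, σ (x c) = x (b * c) := by
  induction hx using Algebra.adjoin_induction with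
  | mem x hx =>
    obtain ⟨a, ξ, hξ, rfl⟩ := hx
    intro c
    simp only [shiftI]
    rw [hb ξ hξ, mul_left_comm]
  | algebraMap r => exact fun c => σ.commutes r
  | add x y _ _ hx hy => intro c; rw [Pi.add_apply, Pi.add_apply, map_add, hx, hy]
  | mul x y _ _ hx hy => intro c; rw [Pi.mul_apply, Pi.mul_apply, map_mul, hx, hy]

lemma finrank_le (K : Type*) [Field K] [NumberField K] (Ξ : Set (NZI (𝓞 K) → Kbar K))
    (hg : ∀ σ : Gal(Kbar K/K), ∃ b : NZI (𝓞 K), ∀ ξ ∈ Ξ, ∀ c, σ (ξ c) = ξ (b * c))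
    [Finite (Quotient (mrel K Ξ))] :
    Module.Finite K (XXi K Ξ) ∧ Module.finrank K (XXi K Ξ) ≤ Nat.card (Quotient (mrel K Ξ)) := by
  classical
  let B := Module.Basis.ofVectorSpace K (XXi K Ξ)
  let Φ : Module.Basis.ofVectorSpaceIndex K (XXi K Ξ) → (Quotient (mrel K Ξ) → Kbar K) :=
    fun i m => (B i).1 m.out
  have hli : LinearIndependent (Kbar K) Φ := by
    rw [linearIndependent_iff']
    intro s g hsum
    by_contra! hne
    obtain ⟨i₀, hi₀, hg0⟩ := hne
    let h : Module.Basis.ofVectorSpaceIndex K (XXi K Ξ) → Kbar K := fun i => g i / g i₀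
    have h1 : ∀ a : NZI (𝓞 K), ∑ i ∈ s, h i * (B i).1 a = 0 := by
      intro a
      have e1 := congrFun hsum (Quotient.mk _ a)
      simp only [Finset.sum_apply, Pi.smul_apply, smul_eq_mul, Pi.zero_apply, Φ] at e1
      have e2 : ∀ i, (B i).1 (Quotient.mk (mrel K Ξ) a).out = (B i).1 a := fun i =>
        X_rel K Ξ _ (B i).2 _ _ (Quotient.mk_out (s := mrel K Ξ) a)
      simp only [e2] at e1
      have : ∑ i ∈ s, h i * (B i).1 a = (g i₀)⁻¹ * ∑ i ∈ s, g i * (B i).1 a := by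
        rw [Finset.mul_sum]
        refine Finset.sum_congr rfl fun i _ => ?_
        simp only [h]
        ring
      rw [this, e1, mul_zero]
    have h2 : ∀ (σ : Gal(Kbar K/K)) (a : NZI (𝓞 K)), ∑ i ∈ s, σ (h i) * (B i).1 a = 0 := by
      intro σ a
      obtain ⟨b, hb⟩ := hg σ.symm
      have e1 : ∀ i, (B i).1 a = σ ((B i).1 (b * a)) := by
        intro i
        rw [← X_gal K Ξ σ.symm b hb _ (B i).2 a, AlgEquiv.apply_symm_apply]
      simp only [e1, ← map_mul, ← map_sum, h1, map_zero]
    let E := IntermediateField.adjoin K (h '' s)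
    have hE : FiniteDimensional K E := by
      have : Finite (h '' (s : Set _)) := (s.finite_toSet.image h).to_subtype
      exact IntermediateField.finiteDimensional_adjoin fun x _ => Algebra.IsIntegral.isIntegral x
    let L : IntermediateField K (Kbar K) := IntermediateField.normalClosure K E (Kbar K)
    have hEL : E ≤ L := IntermediateField.le_normalClosure E
    have hnorm : Normal K L := inferInstance
    have hfd : FiniteDimensional K L := inferInstance
    have hgal : IsGalois K L := ⟨⟩
    have hmem : ∀ i, ∃ l : L, i ∈ s → (l : Kbar K) = h i := by
      intro i
      by_cases his : i ∈ s
      · exact ⟨⟨h i, hEL (IntermediateField.subset_adjoin K _ ⟨i, his, rfl⟩)⟩, fun _ => rfl⟩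
      · exact ⟨0, fun h => absurd h his⟩
    choose l hl using hmem
    have h3 : ∀ a : NZI (𝓞 K), ∑ i ∈ s, algebraMap K (Kbar K) (Algebra.trace K L (l i)) * (B i).1 a = 0 := by
      intro a
      have e1 : ∀ i ∈ s, algebraMap K (Kbar K) (Algebra.trace K L (l i)) =
          ∑ σ : Gal(L/K), (σ.liftNormal (Kbar K)) (h i) := by
        intro i hi
        rw [IsScalarTower.algebraMap_apply K L (Kbar K), trace_eq_sum_automorphisms, map_sum]
        refine Finset.sum_congr rfl fun σ _ => ?_
        rw [← hl i hi]
        exact (AlgEquiv.liftNormal_commutes σ (Kbar K) (l i)).symm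
      rw [Finset.sum_congr rfl (fun i hi => by rw [e1 i hi, Finset.sum_mul]), Finset.sum_comm]
      exact Finset.sum_eq_zero fun σ _ => h2 _ a
    have h4 : ∑ i ∈ s, (Algebra.trace K L (l i)) • B i = 0 := by
      apply Subtype.ext
      funext a
      have := h3 a
      simp only [AddSubmonoidClass.coe_finset_sum, Finset.sum_apply, Subalgebra.coe_smul,
        Pi.smul_apply, Algebra.smul_def]
      exact this
    have h5 := (linearIndependent_iff'.mp B.linearIndependent) s _ h4 i₀ hi₀
    have h6 : l i₀ = 1 := by
      apply Subtype.ext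
      rw [hl i₀ hi₀]
      exact div_self hg0
    rw [h6, show (1 : L) = algebraMap K L 1 by simp, Algebra.trace_algebraMap] at h5
    simp only [nsmul_eq_mul, mul_one, Nat.cast_eq_zero] at h5
    exact Module.finrank_pos.ne' h5
  have := Fintype.ofFinite (Quotient (mrel K Ξ))
  have hfin : Finite (Module.Basis.ofVectorSpaceIndex K (XXi K Ξ)) := hli.finite
  have := Fintype.ofFinite (Module.Basis.ofVectorSpaceIndex K (XXi K Ξ))
  refine ⟨Module.Finite.of_basis B, ?_⟩
  rw [Module.finrank_eq_card_basis B]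
  have := hli.fintype_card_le_finrank
  rwa [Module.finrank_fintype_fun_eq_card, ← Nat.card_eq_fintype_card (α := Quotient _)] at this

end WDFA

/-- For every finite set `Ξ ⊆ W^a_{O_K}(O_K̄)` of integral Witt vectors,
the state complexity of `Ξ` equals `dim_K X_Ξ`; in particular `c_ξ = dim_K X_ξ` for every
single integral Witt vector `ξ`. -/
theorem stateComplexity_eq_finrank
    (Ξ : Set (NZI (𝓞 K) → Kbar K)) (hfin : Ξ.Finite) (hΞ : Ξ ⊆ WittA K) :
    stateComplexity K Ξ = Module.finrank K (XXi K Ξ) := by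
  rw [WDFA.sc_eq K Ξ (fun ξ hξ => (hΞ hξ).1 0)]
  obtain ⟨f, hf⟩ := WDFA.ev_inj K Ξ
  rcases finite_or_infinite (Quotient (WDFA.mrel K Ξ)) with hfi | hi
  · have hT : {t | ∃ ξ ∈ Ξ, ∃ c, ξ c = t}.Finite := by
      refine (Set.Finite.image2 (fun ξ (m : Quotient (WDFA.mrel K Ξ)) => ξ m.out) hfin
        Set.finite_univ).subset ?_
      rintro _ ⟨ξ, hξ, c, rfl⟩
      refine ⟨ξ, hξ, Quotient.mk _ c, trivial, ?_⟩
      have h2 : (WDFA.mrel K Ξ).r (Quotient.mk (WDFA.mrel K Ξ) c).out c :=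
        Quotient.mk_out (s := WDFA.mrel K Ξ) c
      simpa using h2 ξ hξ 1
    obtain ⟨h1, h2⟩ := WDFA.finrank_le K Ξ
      (WDFA.galois_real K Ξ (fun ξ hξ => (hΞ hξ).1 0) (fun ξ hξ => (hΞ hξ).1 1) hT)
    refine le_antisymm ?_ h2
    exact (Nat.card_le_card_of_injective f hf).trans (card_algHom_le_finrank K (XXi K Ξ) (Kbar K))
  · rw [Nat.card_eq_zero_of_infinite, Module.finrank_of_not_finite]
    intro h
    exact (Finite.of_injective f hf).false
end
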